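/- Let m = ⌊n − n^{3/4}·ln n⌋. For any natural number s with s < 2^m, as n → ∞, ∑_{k=0}^{2^{n−m}−1} N(k) = (1 + O(n^{−1})) · (#𝒫_n)² / 2^m, where the implied constant is absolute (in particular uniform in s). -/

import Mathlib

/-- `𝒫 n` is the set of primes `p` with `2^(n-1) < p < 2^n`. -/
def primesP (n : ℕ) : Finset ℕ := (Finset.Ioo (2^(n-1)) (2^n)).filter Nat.Prime

/-- `countN n m s k` is the number of ordered pairs `(p, ℓ)` of primes `p, ℓ ∈ 𝒫 n`
with `p * ℓ ≡ 2^(n-m) * s + k (mod 2^n)`. -/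
def countN (n m : ℕ) (s : ℕ) (k : ℤ) : ℕ :=
  ((primesP n ×ˢ primesP n).filter
    (fun pq => ((pq.1 * pq.2 : ℤ)) ≡ 2 ^ (n - m) * s + k [ZMOD 2 ^ n])).card



/-- In a local ring, equal power sums up to order `D` with `D!` a unit force equal `esymm`. -/
theorem vm_esymm_eq {R : Type*} [CommRing R] {D : ℕ} (x y : Fin D → R)
    (hu : ∀ j : ℕ, 1 ≤ j → j ≤ D → IsUnit (j : R))
    (h : ∀ j : ℕ, 1 ≤ j → j ≤ D → ∑ i, x i ^ j = ∑ i, y i ^ j) (k : ℕ) (hk : k ≤ D) :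
    MvPolynomial.aeval x (MvPolynomial.esymm (Fin D) R k)
      = MvPolynomial.aeval y (MvPolynomial.esymm (Fin D) R k) := by
  induction k using Nat.strong_induction_on with
  | _ k ih =>
    rcases Nat.eq_zero_or_pos k with rfl | hk0
    · simp
    · have key := MvPolynomial.mul_esymm_eq_sum (Fin D) R k
      have kx := congrArg (MvPolynomial.aeval x) key
      have ky := congrArg (MvPolynomial.aeval y) key
      simp only [map_mul, map_natCast, map_pow, map_neg, map_one, map_sum] at kx ky
      have : (k : R) * MvPolynomial.aeval x (MvPolynomial.esymm (Fin D) R k)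
          = (k : R) * MvPolynomial.aeval y (MvPolynomial.esymm (Fin D) R k) := by
        rw [kx, ky]
        congr 1
        apply Finset.sum_congr rfl
        intro a ha
        rw [Finset.mem_filter] at ha
        have ha1 := Finset.HasAntidiagonal.mem_antidiagonal.1 ha.1
        rw [ih a.1 ha.2 (by omega)]
        congr 1
        simp only [MvPolynomial.psum, map_sum, map_pow, MvPolynomial.aeval_X]
        exact h a.2 (by omega) (by omega)
      exact (hu k hk0 hk).mul_left_cancel this

theorem vm_prod_eq {R : Type*} [CommRing R] {D : ℕ} (x y : Fin D → R)
    (hu : ∀ j : ℕ, 1 ≤ j → j ≤ D → IsUnit (j : R))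
    (h : ∀ j : ℕ, 1 ≤ j → j ≤ D → ∑ i, x i ^ j = ∑ i, y i ^ j) (z : R) :
    ∏ i, (z - x i) = ∏ i, (z - y i) := by
  have key : ∀ w : Fin D → R, ∏ i, (z - w i) = ∑ j ∈ Finset.range (D + 1),
      (-1) ^ j * (MvPolynomial.aeval w (MvPolynomial.esymm (Fin D) R j) * z ^ (D - j)) := by
    intro w
    have h1 := Multiset.prod_X_sub_X_eq_sum_esymm (Multiset.map w Finset.univ.val)
    have h2 := congrArg (Polynomial.eval z) h1
    simp only [Multiset.map_map, Multiset.card_map, Finset.card_val, Finset.card_univ,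
      Fintype.card_fin, Polynomial.eval_finsetSum] at h2
    rw [show (Multiset.map ((fun t ↦ Polynomial.X - Polynomial.C t) ∘ w) Finset.univ.val).prod
      = ∏ i, (Polynomial.X - Polynomial.C (w i)) from rfl, Polynomial.eval_prod] at h2
    simp only [Polynomial.eval_sub, Polynomial.eval_X, Polynomial.eval_C] at h2
    rw [h2]
    apply Finset.sum_congr rfl
    intro j hj
    rw [MvPolynomial.aeval_esymm_eq_multiset_esymm]
    simp
  rw [key, key]
  apply Finset.sum_congr rfl
  intro j hj
  rw [vm_esymm_eq x y hu h j (by simp at hj; omega)]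

theorem vm_linnik_unique {p D : ℕ} [hp : Fact p.Prime] (hpD : D < p) (hD : 1 ≤ D)
    (x y : Fin D → ZMod (p ^ D))
    (hx : ∀ i j, i ≠ j → IsUnit (x i - x j))
    (h : ∀ j : ℕ, 1 ≤ j → j ≤ D → ∑ i, x i ^ j = ∑ i, y i ^ j) :
    ∃ σ : Fin D → Fin D, y = x ∘ σ := by
  have hu : ∀ j : ℕ, 1 ≤ j → j ≤ D → IsUnit (j : ZMod (p ^ D)) := by
    intro j h1 h2
    rw [ZMod.isUnit_iff_coprime]
    apply Nat.Coprime.pow_right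
    exact (Nat.coprime_of_lt_prime (by omega) (by omega) hp.out).symm
  have : ∀ i, ∃ a, y i = x a := by
    intro i
    have h0 : ∏ a, (y i - x a) = 0 := by
      rw [vm_prod_eq x y hu h]
      exact Finset.prod_eq_zero (Finset.mem_univ i) (sub_self _)
    have hne : ∃ a, ¬ IsUnit (y i - x a) := by
      by_contra hcon
      push Not at hcon
      have : IsUnit (∏ a, (y i - x a)) := by
        rw [IsUnit.prod_univ_iff]
        exact hcon
      rw [h0] at this
      have : Nontrivial (ZMod (p ^ D)) := by
        apply ZMod.nontrivial_iff.2
        have := Nat.one_lt_pow (by omega : D ≠ 0) hp.out.one_lt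
        omega
      simp_all
    obtain ⟨a, ha⟩ := hne
    refine ⟨a, ?_⟩
    rw [← Finset.mul_prod_erase _ _ (Finset.mem_univ a)] at h0
    have hun : IsUnit (∏ b ∈ Finset.univ.erase a, (y i - x b)) := by
      rw [IsUnit.prod_iff]
      intro b hb
      have hba : a ≠ b := (Finset.ne_of_mem_erase hb).symm
      by_contra hnu
      have nonunit : ∀ z : ZMod (p ^ D), ¬ IsUnit z ↔ (ZMod.castHom (dvd_pow_self p (by omega : D ≠ 0)) (ZMod p)) z = 0 := by
        intro z
        have : NeZero (p ^ D) := ⟨pow_ne_zero _ hp.out.ne_zero⟩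
        obtain ⟨m, rfl⟩ := ZMod.natCast_zmod_surjective z
        rw [ZMod.isUnit_iff_coprime, map_natCast, ZMod.natCast_eq_zero_iff,
          Nat.coprime_pow_right_iff (by omega), Nat.coprime_comm, Nat.Prime.coprime_iff_not_dvd hp.out]
        simp
      have h3 := (nonunit _).1 ha
      have h4 := (nonunit _).1 hnu
      have h5 : (ZMod.castHom (dvd_pow_self p (by omega : D ≠ 0)) (ZMod p)) (x a - x b) = 0 := by
        have : x a - x b = (y i - x b) - (y i - x a) := by ring
        rw [this, map_sub, h3, h4, sub_zero]
      exact (nonunit _).2 h5 (hx a b hba)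
    exact sub_eq_zero.1 ((hun.mul_left_eq_zero).1 h0)
  choose σ hσ using this
  exact ⟨σ, funext hσ⟩


theorem vm_linnik_count {p D M : ℕ} [hp : Fact p.Prime] (hpD : D < p) (hD : 1 ≤ D) (hM : M ≤ p ^ D)
    (c : ℤ) (a : Fin D → ℤ) (S : Finset (Fin D → ℕ))
    (hS1 : ∀ x ∈ S, ∀ i, x i < M)
    (hS2 : ∀ x ∈ S, Function.Injective (fun i => x i % p))
    (hS3 : ∀ x ∈ S, ∀ j : Fin D, ((p : ℤ) ^ (j.1 + 1)) ∣ (∑ i, ((x i : ℤ) - c) ^ (j.1 + 1)) - a j) :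
    S.card ≤ D ^ D * p ^ (D * (D - 1) / 2) := by
  classical
  have hp0 : NeZero (p ^ D) := ⟨pow_ne_zero _ hp.out.ne_zero⟩
  let F : (Fin D → ℕ) → (Fin D → ZMod (p ^ D)) := fun x j =>
    ∑ i, ((x i : ZMod (p ^ D)) - (c : ZMod (p ^ D))) ^ (j.1 + 1)
  let T : Fin D → Finset (ZMod (p ^ D)) := fun j =>
    (Finset.range (p ^ (D - 1 - j.1))).image
      (fun i : ℕ => (a j : ZMod (p ^ D)) + (p : ZMod (p ^ D)) ^ (j.1 + 1) * (i : ZMod (p ^ D)))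
  have hImg : S.image F ⊆ Fintype.piFinset T := by
    intro y hy
    obtain ⟨x, hx, rfl⟩ := Finset.mem_image.1 hy
    rw [Fintype.mem_piFinset]
    intro j
    obtain ⟨q, hq⟩ := hS3 x hx j
    have hppos : (0 : ℤ) < (p : ℤ) ^ (D - 1 - j.1) := by
      have := hp.out.pos
      positivity
    have hmod := Int.emod_nonneg q hppos.ne'
    have hmod2 := Int.emod_lt_of_pos q hppos
    refine Finset.mem_image.2 ⟨(q % (p : ℤ) ^ (D - 1 - j.1)).toNat, ?_, ?_⟩
    · rw [Finset.mem_range]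
      zify
      rw [Int.toNat_of_nonneg hmod]
      exact hmod2
    · have e1 : F x j = (((∑ i, ((x i : ℤ) - c) ^ (j.1 + 1)) : ℤ) : ZMod (p ^ D)) := by
        simp [F]
      rw [e1]
      have e2 : (((q % (p : ℤ) ^ (D - 1 - j.1)).toNat : ℕ) : ZMod (p ^ D))
          = ((q % (p : ℤ) ^ (D - 1 - j.1) : ℤ) : ZMod (p ^ D)) := by
        rw [← Int.cast_natCast, Int.toNat_of_nonneg hmod]
      rw [e2]
      have e3 : (∑ i, ((x i : ℤ) - c) ^ (j.1 + 1)) = a j + (p : ℤ) ^ (j.1 + 1) * q := by linarith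
      rw [e3]
      have e4 : (p : ℤ) ^ (j.1 + 1) * q = (p : ℤ) ^ (j.1 + 1) * (q % (p : ℤ) ^ (D - 1 - j.1))
          + ((p ^ D : ℕ) : ℤ) * (q / (p : ℤ) ^ (D - 1 - j.1)) := by
        have h1 := Int.emod_add_mul_ediv q ((p : ℤ) ^ (D - 1 - j.1))
        have h2 : ((p ^ D : ℕ) : ℤ) = (p : ℤ) ^ (j.1 + 1) * (p : ℤ) ^ (D - 1 - j.1) := by
          rw [← pow_add]
          push_cast
          congr 1
          have := j.2
          omega
        rw [h2]
        nth_rewrite 1 [← h1]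
        ring
      rw [e4]
      push_cast
      have h6 : (p : ZMod (p ^ D)) ^ D = 0 := by
        have := ZMod.natCast_self (p ^ D)
        push_cast at this
        exact this
      rw [h6]
      ring
  have hcardT : (Fintype.piFinset T).card ≤ p ^ (D * (D - 1) / 2) := by
    rw [Fintype.card_piFinset]
    calc ∏ j, (T j).card ≤ ∏ j : Fin D, p ^ (D - 1 - j.1) := by
          apply Finset.prod_le_prod' 
          intro j _
          exact Finset.card_image_le.trans (by simp)
      _ = p ^ (∑ j : Fin D, (D - 1 - j.1)) := by rw [Finset.prod_pow_eq_pow_sum]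
      _ = p ^ (D * (D - 1) / 2) := by
          congr 1
          rw [← Finset.sum_range_id D, Fin.sum_univ_eq_sum_range (fun j => D - 1 - j) D]
          exact Finset.sum_range_reflect (fun j => j) D
  have hfib : ∀ b ∈ S.image F, (S.filter (fun x => F x = b)).card ≤ D ^ D := by
    intro b hb
    obtain ⟨x0, hx0, rfl⟩ := Finset.mem_image.1 hb
    have hsub : S.filter (fun x => F x = F x0) ⊆
        (Finset.univ : Finset (Fin D → Fin D)).image (fun σ => x0 ∘ σ) := by
      intro x hx
      rw [Finset.mem_filter] at hx
      have huni : ∀ i j, i ≠ j → IsUnit (((x0 i : ZMod (p ^ D)) - (c : ZMod (p ^ D)))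
          - ((x0 j : ZMod (p ^ D)) - (c : ZMod (p ^ D)))) := by
        intro i j hij
        have e : ((x0 i : ZMod (p ^ D)) - (c : ZMod (p ^ D)))
          - ((x0 j : ZMod (p ^ D)) - (c : ZMod (p ^ D))) = (((x0 i : ℤ) - (x0 j : ℤ) : ℤ) : ZMod (p ^ D)) := by
          push_cast
          ring
        rw [e]
        rw [ZMod.coe_int_isUnit_iff_isCoprime]
        push_cast
        apply IsCoprime.pow_left
        rw [(Nat.prime_iff_prime_int.1 hp.out).irreducible.coprime_iff_not_dvd]
        intro hd
        apply hij
        apply hS2 x0 hx0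
        have := (Int.modEq_iff_dvd.2 hd)
        exact ((Int.natCast_modEq_iff.1 this).symm)
      obtain ⟨σ, hσ⟩ := vm_linnik_unique hpD hD
        (fun i => (x0 i : ZMod (p ^ D)) - (c : ZMod (p ^ D)))
        (fun i => (x i : ZMod (p ^ D)) - (c : ZMod (p ^ D))) huni (by
          intro j h1 h2
          have := congrFun hx.2 ⟨j - 1, by omega⟩
          simp only [F] at this
          rw [show j - 1 + 1 = j by omega] at this
          exact this.symm)
      refine Finset.mem_image.2 ⟨σ, Finset.mem_univ _, ?_⟩
      funext i
      have h1 := congrFun hσ i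
      simp only [Function.comp] at h1 ⊢
      have h2 : ((x i : ℕ) : ZMod (p ^ D)) = ((x0 (σ i) : ℕ) : ZMod (p ^ D)) := sub_left_injective h1
      rw [ZMod.natCast_eq_natCast_iff'] at h2
      rw [Nat.mod_eq_of_lt ((hS1 x hx.1 i).trans_le hM),
        Nat.mod_eq_of_lt ((hS1 x0 hx0 _).trans_le hM)] at h2
      exact h2.symm
    calc _ ≤ _ := Finset.card_le_card hsub
      _ ≤ _ := Finset.card_image_le
      _ = D ^ D := by simp
  calc S.card ≤ D ^ D * (S.image F).card := Finset.card_le_mul_card_image S _ hfib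
    _ ≤ _ := Nat.mul_le_mul_left _ ((Finset.card_le_card hImg).trans hcardT)


/-- additive energy -/
def vmE {α Γ : Type*} [DecidableEq Γ] (Z : Finset α) (φ : α → Γ) : ℕ :=
  ((Z ×ˢ Z).filter (fun q => φ q.1 = φ q.2)).card

theorem vmE_cross {α β Γ : Type*} [DecidableEq Γ] (Z : Finset α) (Y : Finset β) (f : α → Γ) (g : β → Γ)
    (T : Finset Γ) (hT : ∀ z ∈ Z, f z ∈ T) :
    ((Z ×ˢ Y).filter (fun q => f q.1 = g q.2)).card
      = ∑ t ∈ T, (Z.filter (fun z => f z = t)).card * (Y.filter (fun z => g z = t)).card := by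
  classical
  rw [Finset.card_eq_sum_card_fiberwise (f := fun q => f q.1) (t := T)]
  · apply Finset.sum_congr rfl
    intro t _
    rw [← Finset.card_product]
    congr 1
    ext ⟨a, b⟩
    simp only [Finset.mem_filter, Finset.mem_product]
    constructor
    · rintro ⟨⟨⟨h1, h2⟩, h3⟩, h4⟩
      exact ⟨⟨h1, h4⟩, h2, by rw [← h3, h4]⟩
    · rintro ⟨⟨h1, h2⟩, h3, h4⟩
      exact ⟨⟨⟨h1, h3⟩, by rw [h2, h4]⟩, h2⟩
  · intro q hq
    simp only [Finset.coe_filter, Finset.mem_product, Set.mem_ofPred_eq] at hq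
    exact hT _ hq.1.1

theorem vmE_eq_sum {α Γ : Type*} [DecidableEq Γ] (Z : Finset α) (φ : α → Γ)
    (T : Finset Γ) (hT : ∀ z ∈ Z, φ z ∈ T) :
    vmE Z φ = ∑ t ∈ T, (Z.filter (fun z => φ z = t)).card ^ 2 := by
  rw [vmE, vmE_cross Z Z φ φ T hT]
  simp only [sq]

theorem vmE_two_mul {α Γ : Type*} [DecidableEq Γ] (Y : Finset α) (f g : α → Γ) :
    2 * ((Y ×ˢ Y).filter (fun q => f q.1 = g q.2)).card ≤ vmE Y f + vmE Y g := by
  classical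
  have hf : ∀ z ∈ Y, f z ∈ Y.image f ∪ Y.image g := fun z hz =>
    Finset.mem_union_left _ (Finset.mem_image_of_mem f hz)
  have hg : ∀ z ∈ Y, g z ∈ Y.image f ∪ Y.image g := fun z hz =>
    Finset.mem_union_right _ (Finset.mem_image_of_mem g hz)
  rw [vmE_cross Y Y f g _ hf, vmE_eq_sum Y f _ hf, vmE_eq_sum Y g _ hg, Finset.mul_sum,
    ← Finset.sum_add_distrib]
  apply Finset.sum_le_sum
  intro t _
  generalize (Finset.filter (fun z => f z = t) Y).card = a
  generalize (Finset.filter (fun z => g z = t) Y).card = b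
  zify
  nlinarith [sq_nonneg ((a : ℤ) - b)]

theorem vmE_shift {α Γ : Type*} [DecidableEq Γ] [AddCommGroup Γ] (Y : Finset α) (b : α → Γ) (u v : Γ) :
    ((Y ×ˢ Y).filter (fun q => u + b q.1 = v + b q.2)).card ≤ vmE Y b := by
  have h := vmE_two_mul Y (fun y => u + b y) (fun y => v + b y)
  have h1 : ∀ w : Γ, vmE Y (fun y => w + b y) = vmE Y b := by
    intro w
    simp [vmE]
  rw [h1, h1] at h
  omega

theorem vmE_cover {α Γ ι : Type*} [DecidableEq Γ] [DecidableEq α] (Z : Finset α) (φ : α → Γ) (S : Finset ι)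
    (W : ι → Finset α) (hW : ∀ z ∈ Z, ∃ e ∈ S, z ∈ W e) :
    vmE Z φ ≤ S.card * ∑ e ∈ S, vmE (W e) φ := by
  classical
  set T : Finset Γ := Z.image φ ∪ S.biUnion (fun e => (W e).image φ)
  have hZ : ∀ z ∈ Z, φ z ∈ T := fun z hz => Finset.mem_union_left _ (Finset.mem_image_of_mem _ hz)
  have hWT : ∀ e ∈ S, ∀ z ∈ W e, φ z ∈ T := fun e he z hz => Finset.mem_union_right _
    (Finset.mem_biUnion.2 ⟨e, he, Finset.mem_image_of_mem _ hz⟩)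
  rw [vmE_eq_sum Z φ T hZ]
  rw [Finset.sum_congr rfl (fun e he => vmE_eq_sum (W e) φ T (hWT e he)), Finset.sum_comm,
    Finset.mul_sum]
  apply Finset.sum_le_sum
  intro t _
  calc (Z.filter (fun z => φ z = t)).card ^ 2
      ≤ (∑ e ∈ S, ((W e).filter (fun z => φ z = t)).card) ^ 2 := by
        apply Nat.pow_le_pow_left
        refine le_trans (Finset.card_le_card ?_) Finset.card_biUnion_le
        intro z hz
        rw [Finset.mem_filter] at hz
        obtain ⟨e, he, hze⟩ := hW z hz.1
        exact Finset.mem_biUnion.2 ⟨e, he, Finset.mem_filter.2 ⟨hze, hz.2⟩⟩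
    _ ≤ _ := sq_sum_le_card_mul_sum_sq

theorem vmE_cover_two {α Γ : Type*} [DecidableEq Γ] [DecidableEq α] (Z : Finset α) (φ : α → Γ)
    (W1 W2 : Finset α) (hW : ∀ z ∈ Z, z ∈ W1 ∨ z ∈ W2) :
    vmE Z φ ≤ 2 * vmE W1 φ + 2 * vmE W2 φ := by
  have := vmE_cover Z φ (Finset.univ : Finset Bool) (fun b => if b then W1 else W2) (by
    intro z hz
    rcases hW z hz with h | h
    · exact ⟨true, by simp, by simpa using h⟩
    · exact ⟨false, by simp, by simpa using h⟩)
  simp at this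
  omega

theorem vmE_mono {α Γ : Type*} [DecidableEq Γ] (Z W : Finset α) (φ : α → Γ) (h : Z ⊆ W) :
    vmE Z φ ≤ vmE W φ := by
  apply Finset.card_le_card
  apply Finset.filter_subset_filter
  exact Finset.product_subset_product h h

theorem vmE_parseval {α G : Type*} [AddCommGroup G] [Fintype G] [DecidableEq G] (Z : Finset α) (φ : α → G) :
    ∑ ψ : AddChar G ℂ, ‖∑ z ∈ Z, ψ (φ z)‖ ^ 2 = (Fintype.card G : ℝ) * vmE Z φ := by
  have h : ((∑ ψ : AddChar G ℂ, ‖∑ z ∈ Z, ψ (φ z)‖ ^ 2 : ℝ) : ℂ) = ((Fintype.card G : ℝ) * vmE Z φ : ℝ) := by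
    push_cast
    have h1 : ∀ ψ : AddChar G ℂ, ((‖∑ z ∈ Z, ψ (φ z)‖ : ℝ) : ℂ) ^ 2 = ∑ q ∈ Z ×ˢ Z, ψ (φ q.1 - φ q.2) := by
      intro ψ
      rw [← Complex.mul_conj', map_sum, Finset.sum_mul_sum, Finset.sum_product]
      apply Finset.sum_congr rfl
      intro x _
      apply Finset.sum_congr rfl
      intro y _
      rw [sub_eq_add_neg, AddChar.map_add_eq_mul, AddChar.map_neg_eq_conj]
    simp_rw [h1]
    rw [Finset.sum_comm]
    simp_rw [AddChar.sum_apply_eq_ite, sub_eq_zero]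
    rw [Finset.sum_ite, Finset.sum_const_zero, add_zero, Finset.sum_const, vmE]
    simp [mul_comm]
  exact_mod_cast h


/-- power vector -/
def vmS (D : ℕ) (v : ℕ) : Fin D → ℤ := fun j => (v : ℤ) ^ (j.1 + 1)

/-- power sums -/
def vmPS (D : ℕ) {k : ℕ} (v : Fin k → ℕ) : Fin D → ℤ := fun j => ∑ i, (v i : ℤ) ^ (j.1 + 1)

/-- The Vinogradov counting function over a finite set `V` of naturals. -/
def vmJ (D k : ℕ) (V : Finset ℕ) : ℕ := vmE (Fintype.piFinset (fun _ : Fin k => V)) (vmPS D)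

theorem vmPS_eq_sum (D : ℕ) {k : ℕ} (v : Fin k → ℕ) : vmPS D v = ∑ i, vmS D (v i) := by
  funext j
  simp [vmPS, vmS]

theorem vm_translate {ι : Type*} [Fintype ι] (D : ℕ) (z w : ι → ℤ) (c : ℤ)
    (h : ∀ j : Fin D, ∑ i, z i ^ (j.1 + 1) = ∑ i, w i ^ (j.1 + 1)) (j : Fin D) :
    ∑ i, (z i - c) ^ (j.1 + 1) = ∑ i, (w i - c) ^ (j.1 + 1) := by
  simp_rw [sub_eq_add_neg, add_pow]
  rw [Finset.sum_comm, Finset.sum_comm (s := Finset.univ) (t := Finset.range (j.1 + 1 + 1))]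
  apply Finset.sum_congr rfl
  intro m hm
  rw [← Finset.sum_mul, ← Finset.sum_mul, ← Finset.sum_mul, ← Finset.sum_mul]
  congr 2
  rcases Nat.eq_zero_or_pos m with rfl | hm0
  · simp
  · have hm' : m - 1 < D := by
      have := j.2
      rw [Finset.mem_range] at hm
      omega
    have := h ⟨m - 1, hm'⟩
    simp only at this
    rwa [show m - 1 + 1 = m by omega] at this

theorem vmJ_image (D k : ℕ) (V : Finset ℕ) (c l : ℕ) (hl : 0 < l) :
    vmJ D k (V.image (fun y => c + l * y)) ≤ vmJ D k V := by
  classical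
  have hinj : Function.Injective (fun y : ℕ => c + l * y) := by
    intro a b h
    simp only at h
    exact Nat.eq_of_mul_eq_mul_left hl (by omega)
  unfold vmJ vmE
  apply Finset.card_le_card_of_surjOn
    (f := fun q : (Fin k → ℕ) × (Fin k → ℕ) => ((fun i => c + l * q.1 i), (fun i => c + l * q.2 i)))
  rintro ⟨v, w⟩ hvw
  simp only [Finset.coe_filter, Finset.mem_product, Fintype.mem_piFinset, Set.mem_ofPred_eq,
    Finset.mem_image] at hvw
  obtain ⟨⟨hv, hw⟩, he⟩ := hvw
  choose v' hv' hv2 using hv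
  choose w' hw' hw2 using hw
  refine ⟨(v', w'), ?_, ?_⟩
  · simp only [Finset.coe_filter, Finset.mem_product, Fintype.mem_piFinset, Set.mem_ofPred_eq]
    refine ⟨⟨hv', hw'⟩, ?_⟩
    funext j
    have h1 := vm_translate D (fun i => (v i : ℤ)) (fun i => (w i : ℤ)) c (fun j => congrFun he j) j
    have e1 : ∀ i, ((v i : ℤ) - c) = l * (v' i : ℤ) := by
      intro i
      rw [← hv2 i]
      push_cast
      ring
    have e2 : ∀ i, ((w i : ℤ) - c) = l * (w' i : ℤ) := by
      intro i
      rw [← hw2 i]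
      push_cast
      ring
    simp only [e1, e2, mul_pow, ← Finset.mul_sum] at h1
    have hl' : (l : ℤ) ^ (j.1 + 1) ≠ 0 := by positivity
    exact mul_left_cancel₀ hl' h1
  · simp only [Prod.mk.injEq]
    exact ⟨funext hv2, funext hw2⟩

/-- the residue class part of `range (l * P)` -/
theorem vm_class_eq (l P c : ℕ) (hc : c < l) :
    (Finset.range (l * P)).filter (fun v => v % l = c) = (Finset.range P).image (fun y => c + l * y) := by
  ext v
  simp only [Finset.mem_filter, Finset.mem_range, Finset.mem_image]
  constructor
  · rintro ⟨h1, h2⟩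
    refine ⟨v / l, Nat.div_lt_of_lt_mul h1, ?_⟩
    rw [← h2]
    exact Nat.mod_add_div v l
  · rintro ⟨y, hy, rfl⟩
    refine ⟨?_, by simp [Nat.mod_eq_of_lt hc]⟩
    calc c + l * y < l + l * y := by omega
      _ = l * (y + 1) := by ring
      _ ≤ l * P := Nat.mul_le_mul_left _ hy

/-- The mixed count. -/
theorem vm_mixed {p D k P : ℕ} [hp : Fact p.Prime] (hpD : D < p) (hD : 1 ≤ D) (hP : p * P ≤ p ^ D)
    (c : ℕ) (X : Finset (Fin D → ℕ)) (hX1 : ∀ x ∈ X, ∀ i, x i < p * P)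
    (hX2 : ∀ x ∈ X, Function.Injective (fun i => x i % p)) :
    vmE (X ×ˢ Fintype.piFinset (fun _ : Fin k => (Finset.range P).image (fun y => c + p * y)))
      (fun q => vmPS D q.1 + vmPS D q.2)
      ≤ ((p * P) ^ D * (D ^ D * p ^ (D * (D - 1) / 2))) * vmJ D k (Finset.range P) := by
  classical
  set Y := Fintype.piFinset (fun _ : Fin k => (Finset.range P).image (fun y => c + p * y)) with hY
  let W := (X ×ˢ X).filter (fun q => ∀ j : Fin D, ((p : ℤ) ^ (j.1 + 1)) ∣
    (∑ i, ((q.2 i : ℤ) - c) ^ (j.1 + 1)) - (∑ i, ((q.1 i : ℤ) - c) ^ (j.1 + 1)))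
  have hXc : X.card ≤ (p * P) ^ D := by
    have : X ⊆ Fintype.piFinset (fun _ : Fin D => Finset.range (p * P)) := by
      intro x hx
      rw [Fintype.mem_piFinset]
      intro i
      exact Finset.mem_range.2 (hX1 x hx i)
    refine (Finset.card_le_card this).trans ?_
    simp
  have hWc : W.card ≤ (p * P) ^ D * (D ^ D * p ^ (D * (D - 1) / 2)) := by
    have h1 : W.card = ∑ x ∈ X, (W.filter (fun q => q.1 = x)).card := by
      apply Finset.card_eq_sum_card_fiberwise
      intro q hq
      have := (Finset.mem_filter.1 (Finset.mem_coe.1 hq)).1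
      exact (Finset.mem_product.1 this).1
    rw [h1]
    calc _ ≤ ∑ x ∈ X, (D ^ D * p ^ (D * (D - 1) / 2)) := by
          apply Finset.sum_le_sum
          intro x hx
          have h2 : (W.filter (fun q => q.1 = x)).card = ((W.filter (fun q => q.1 = x)).image Prod.snd).card := by
            rw [Finset.card_image_of_injOn]
            intro q hq q' hq' hqq
            have a1 := (Finset.mem_filter.1 (Finset.mem_coe.1 hq)).2
            have a2 := (Finset.mem_filter.1 (Finset.mem_coe.1 hq')).2
            exact Prod.ext (a1.trans a2.symm) hqq
          rw [h2]
          have key : ∀ z ∈ (W.filter (fun q => q.1 = x)).image Prod.snd, z ∈ X ∧ ∀ j : Fin D,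
            ((p : ℤ) ^ (j.1 + 1)) ∣ (∑ i, ((z i : ℤ) - (c : ℤ)) ^ (j.1 + 1)) - (∑ i, ((x i : ℤ) - c) ^ (j.1 + 1)) := by
            intro z hz
            obtain ⟨q, hq, rfl⟩ := Finset.mem_image.1 hz
            rw [Finset.mem_filter] at hq
            obtain ⟨hq1, rfl⟩ := hq
            rw [Finset.mem_filter] at hq1
            exact ⟨(Finset.mem_product.1 hq1.1).2, hq1.2⟩
          exact vm_linnik_count hpD hD hP (c : ℤ) (fun j => ∑ i, ((x i : ℤ) - c) ^ (j.1 + 1)) _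
            (fun z hz => hX1 z (key z hz).1) (fun z hz => hX2 z (key z hz).1) (fun z hz => (key z hz).2)
      _ = X.card * (D ^ D * p ^ (D * (D - 1) / 2)) := by simp
      _ ≤ _ := Nat.mul_le_mul_right _ hXc
  have hmain : vmE (X ×ˢ Y) (fun q => vmPS D q.1 + vmPS D q.2) ≤ W.card * vmE Y (vmPS D) := by
    rw [vmE]
    rw [Finset.card_eq_sum_card_fiberwise (f := fun q => (q.1.1, q.2.1)) (t := W)]
    · rw [← smul_eq_mul]
      apply Finset.sum_le_card_nsmul
      rintro ⟨x, x'⟩ hxx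
      refine le_trans ?_ (vmE_shift Y (vmPS D) (vmPS D x) (vmPS D x'))
      apply Finset.card_le_card_of_injOn (fun q => (q.1.2, q.2.2))
      · intro q hq
        simp only [Finset.coe_filter, Finset.mem_filter, Finset.mem_product, Set.mem_ofPred_eq,
          Prod.mk.injEq] at hq ⊢
        obtain ⟨⟨⟨⟨h1, h2⟩, h3, h4⟩, h5⟩, h6, h7⟩ := hq
        refine ⟨⟨h2, h4⟩, ?_⟩
        rw [← h6, ← h7]
        exact h5
      · intro q hq q' hq' hqq
        simp only [Finset.coe_filter, Finset.mem_filter, Finset.mem_product, Set.mem_ofPred_eq,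
          Prod.mk.injEq] at hq hq' hqq
        refine Prod.ext (Prod.ext ?_ hqq.1) (Prod.ext ?_ hqq.2)
        · rw [hq.2.1, hq'.2.1]
        · rw [hq.2.2, hq'.2.2]
    · rintro ⟨⟨x, y⟩, x', y'⟩ hq
      simp only [Finset.coe_filter, Finset.mem_product, Set.mem_ofPred_eq] at hq
      obtain ⟨⟨⟨h1, h2⟩, h3, h4⟩, h5⟩ := hq
      refine Finset.mem_coe.2 (Finset.mem_filter.2 ⟨Finset.mem_product.2 ⟨h1, h3⟩, ?_⟩)
      intro j
      have ht := vm_translate (ι := Fin D ⊕ Fin k) D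
        (Sum.elim (fun i => (x i : ℤ)) (fun i => (y i : ℤ)))
        (Sum.elim (fun i => (x' i : ℤ)) (fun i => (y' i : ℤ))) c (by
          intro j
          have := congrFun h5 j
          simpa [vmPS] using this) j
      simp only [Fintype.sum_sum_type, Sum.elim_inl, Sum.elim_inr] at ht
      have hdv : ∀ u ∈ Y, ((p : ℤ) ^ (j.1 + 1)) ∣ ∑ i, ((u i : ℤ) - c) ^ (j.1 + 1) := by
        intro u hu
        apply Finset.dvd_sum
        intro i _
        apply pow_dvd_pow_of_dvd
        rw [hY, Fintype.mem_piFinset] at hu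
        obtain ⟨y0, _, h0⟩ := Finset.mem_image.1 (hu i)
        rw [← h0]
        push_cast
        exact ⟨y0, by ring⟩
      have e : (∑ i, ((x' i : ℤ) - c) ^ (j.1 + 1)) - (∑ i, ((x i : ℤ) - c) ^ (j.1 + 1))
         = (∑ i, ((y i : ℤ) - c) ^ (j.1 + 1)) - (∑ i, ((y' i : ℤ) - c) ^ (j.1 + 1)) := by linarith
      rw [e]
      exact dvd_sub (hdv y h2) (hdv y' h4)
  refine hmain.trans (Nat.mul_le_mul hWc ?_)
  exact vmJ_image D k (Finset.range P) c p hp.out.pos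


theorem vm_exists_mod {D : ℕ} (T : Finset (Fin D → ℤ)) :
    ∃ Q : ℕ, 0 < Q ∧ ∀ t ∈ T, ∀ t' ∈ T, (∀ j, ((t j : ℤ) : ZMod Q) = ((t' j : ℤ) : ZMod Q)) → t = t' := by
  set B : ℕ := ∑ t ∈ T, ∑ j, (t j).natAbs with hB
  have hb : ∀ t ∈ T, ∀ j, (t j).natAbs ≤ B := by
    intro t ht j
    calc (t j).natAbs ≤ ∑ j, (t j).natAbs :=
          Finset.single_le_sum (f := fun j => (t j).natAbs) (fun _ _ => Nat.zero_le _) (Finset.mem_univ j)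
      _ ≤ B := Finset.single_le_sum (f := fun t => ∑ j, (t j).natAbs) (fun _ _ => Nat.zero_le _) ht
  refine ⟨2 * B + 1, by omega, ?_⟩
  intro t ht t' ht' h
  funext j
  have h1 := (ZMod.intCast_eq_intCast_iff_dvd_sub _ _ _).1 (h j)
  have a1 := hb t ht j
  have a2 := hb t' ht' j
  by_contra hne
  have := Int.natAbs_le_of_dvd_ne_zero h1 (by omega)
  omega

theorem vm_card_pow_sum {ι : Type*} (S : Finset ι) (f : ι → ℂ) (n : ℕ) (hn : 1 ≤ n) :
    ‖∑ c ∈ S, f c‖ ^ n ≤ (S.card : ℝ) ^ (n - 1) * ∑ c ∈ S, ‖f c‖ ^ n := by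
  obtain ⟨n, rfl⟩ : ∃ m, n = m + 1 := ⟨n - 1, by omega⟩
  calc ‖∑ c ∈ S, f c‖ ^ (n + 1) ≤ (∑ c ∈ S, ‖f c‖) ^ (n + 1) := by
        gcongr
        exact norm_sum_le _ _
    _ ≤ _ := pow_sum_le_card_mul_sum_pow (fun c _ => norm_nonneg (f c)) n

theorem vmE_holder_fin {α β G ι : Type*} [AddCommGroup G] [Fintype G] [DecidableEq G] [DecidableEq β]
    (X : Finset α) (φ : α → G) (g : β → G) (S : Finset ι) (W : ι → Finset β)
    (hW : (S : Set ι).PairwiseDisjoint W) (k : ℕ) (hk : 1 ≤ k) :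
    vmE (X ×ˢ Fintype.piFinset (fun _ : Fin k => S.biUnion W)) (fun q => φ q.1 + ∑ i, g (q.2 i))
     ≤ S.card ^ (2 * k - 1) * ∑ c ∈ S,
      vmE (X ×ˢ Fintype.piFinset (fun _ : Fin k => W c)) (fun q => φ q.1 + ∑ i, g (q.2 i)) := by
  classical
  have hexp : ∀ (ψ : AddChar G ℂ) (V : Finset β),
      ∑ q ∈ X ×ˢ Fintype.piFinset (fun _ : Fin k => V), ψ (φ q.1 + ∑ i, g (q.2 i))
       = (∑ x ∈ X, ψ (φ x)) * (∑ v ∈ V, ψ (g v)) ^ k := by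
    intro ψ V
    have h1 : (∑ v ∈ V, ψ (g v)) ^ k = ∑ v ∈ Fintype.piFinset (fun _ : Fin k => V), ∏ i, ψ (g (v i)) := by
      rw [← Finset.prod_univ_sum (fun _ : Fin k => V) (fun _ v => ψ (g v))]
      simp
    rw [h1, Finset.sum_mul_sum, Finset.sum_product]
    refine Finset.sum_congr rfl fun x _ => Finset.sum_congr rfl fun v _ => ?_
    rw [AddChar.map_add_eq_mul]
    congr 1
    exact map_prod ψ.toMonoidHom (fun i => Multiplicative.ofAdd (g (v i))) Finset.univ
  have hG : (0 : ℝ) < Fintype.card G := by exact_mod_cast Fintype.card_pos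
  have key : (Fintype.card G : ℝ) * (vmE (X ×ˢ Fintype.piFinset (fun _ : Fin k => S.biUnion W)) (fun q => φ q.1 + ∑ i, g (q.2 i)) : ℝ)
     ≤ (Fintype.card G : ℝ) * ((S.card : ℝ) ^ (2 * k - 1) * ∑ c ∈ S,
      (vmE (X ×ˢ Fintype.piFinset (fun _ : Fin k => W c)) (fun q => φ q.1 + ∑ i, g (q.2 i)) : ℝ)) := by
    rw [← vmE_parseval, mul_left_comm, Finset.mul_sum]
    simp_rw [← vmE_parseval, hexp]
    rw [Finset.sum_comm, Finset.mul_sum]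
    apply Finset.sum_le_sum
    intro ψ _
    rw [Finset.sum_biUnion hW, norm_mul, mul_pow, norm_pow, ← pow_mul, mul_comm k 2]
    simp_rw [norm_mul, mul_pow, norm_pow, ← pow_mul, mul_comm k 2]
    rw [← Finset.mul_sum, mul_left_comm]
    gcongr
    exact vm_card_pow_sum S _ _ (by omega)
  have := le_of_mul_le_mul_left key hG
  exact_mod_cast this

theorem vmE_holder {α ι : Type*} {D : ℕ}
    (X : Finset α) (φ : α → (Fin D → ℤ)) (S : Finset ι) (W : ι → Finset ℕ)
    (hW : (S : Set ι).PairwiseDisjoint W) (k : ℕ) (hk : 1 ≤ k) :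
    vmE (X ×ˢ Fintype.piFinset (fun _ : Fin k => S.biUnion W)) (fun q => φ q.1 + vmPS D q.2)
     ≤ S.card ^ (2 * k - 1) * ∑ c ∈ S,
      vmE (X ×ˢ Fintype.piFinset (fun _ : Fin k => W c)) (fun q => φ q.1 + vmPS D q.2) := by
  classical
  set Z := X ×ˢ Fintype.piFinset (fun _ : Fin k => S.biUnion W) with hZ
  set Φ : α × (Fin k → ℕ) → (Fin D → ℤ) := fun q => φ q.1 + vmPS D q.2 with hΦ
  obtain ⟨Q, hQ, hinj⟩ := vm_exists_mod (Z.image Φ)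
  have : NeZero Q := ⟨by omega⟩
  let ca : (Fin D → ℤ) → (Fin D → ZMod Q) := fun t j => (t j : ZMod Q)
  have hsub : ∀ c ∈ S, X ×ˢ Fintype.piFinset (fun _ : Fin k => W c) ⊆ Z := by
    intro c hc
    apply Finset.product_subset_product_right
    apply Fintype.piFinset_subset
    intro _
    exact Finset.subset_biUnion_of_mem W hc
  have htr : ∀ Y ⊆ Z, vmE Y Φ = vmE Y (fun q => ca (φ q.1) + ∑ i, ca (vmS D (q.2 i))) := by
    intro Y hY
    have e : (fun q : α × (Fin k → ℕ) => ca (φ q.1) + ∑ i, ca (vmS D (q.2 i))) = fun q => ca (Φ q) := by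
      funext q j
      simp [ca, hΦ, vmPS, vmS]
    rw [e, vmE, vmE]
    congr 1
    apply Finset.filter_congr
    intro q hq
    rw [Finset.mem_product] at hq
    constructor
    · intro h
      rw [h]
    · intro h
      exact hinj _ (Finset.mem_image_of_mem _ (hY hq.1)) _ (Finset.mem_image_of_mem _ (hY hq.2))
        (fun j => congrFun h j)
  rw [htr Z (Finset.Subset.refl _), Finset.sum_congr rfl (fun c hc => htr _ (hsub c hc))]
  exact vmE_holder_fin X (fun x => ca (φ x)) (fun v => ca (vmS D v)) S W hW k hk


theorem vmE_le_of_inj {α β Γ : Type*} [DecidableEq Γ] (Z : Finset α) (Y : Finset β) (φ : α → Γ) (ψ : β → Γ)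
    (f : α → β) (hf : ∀ z ∈ Z, f z ∈ Y) (hinj : Function.Injective f) (h : ∀ z ∈ Z, ψ (f z) = φ z) :
    vmE Z φ ≤ vmE Y ψ := by
  unfold vmE
  apply Finset.card_le_card_of_injOn (fun q => (f q.1, f q.2))
  · intro q hq
    simp only [Finset.coe_filter, Finset.mem_product, Set.mem_ofPred_eq] at hq ⊢
    refine ⟨⟨hf _ hq.1.1, hf _ hq.1.2⟩, ?_⟩
    rw [h _ hq.1.1, h _ hq.1.2, hq.2]
  · intro q _ q' _ hqq
    simp only [Prod.mk.injEq] at hqq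
    exact Prod.ext (hinj hqq.1) (hinj hqq.2)

theorem vmE_prod_le {α β Γ : Type*} [DecidableEq Γ] [AddCommGroup Γ] (X : Finset α) (Y : Finset β)
    (a : α → Γ) (b : β → Γ) :
    vmE (X ×ˢ Y) (fun q => a q.1 + b q.2) ≤ X.card ^ 2 * vmE Y b := by
  classical
  rw [vmE]
  rw [Finset.card_eq_sum_card_fiberwise (f := fun q => (q.1.1, q.2.1)) (t := X ×ˢ X)]
  · rw [sq, ← Finset.card_product, ← smul_eq_mul]
    apply Finset.sum_le_card_nsmul
    rintro ⟨x, x'⟩ hxx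
    refine le_trans ?_ (vmE_shift Y b (a x) (a x'))
    apply Finset.card_le_card_of_injOn (fun q => (q.1.2, q.2.2))
    · intro q hq
      simp only [Finset.coe_filter, Finset.mem_filter, Finset.mem_product, Set.mem_ofPred_eq,
        Prod.mk.injEq] at hq ⊢
      obtain ⟨⟨⟨⟨h1, h2⟩, h3, h4⟩, h5⟩, h6, h7⟩ := hq
      refine ⟨⟨h2, h4⟩, ?_⟩
      rw [← h6, ← h7]
      exact h5
    · intro q hq q' hq' hqq
      simp only [Finset.coe_filter, Finset.mem_filter, Finset.mem_product, Set.mem_ofPred_eq,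
        Prod.mk.injEq] at hq hq' hqq
      refine Prod.ext (Prod.ext ?_ hqq.1) (Prod.ext ?_ hqq.2)
      · rw [hq.2.1, hq'.2.1]
      · rw [hq.2.2, hq'.2.2]
  · rintro ⟨⟨x, y⟩, x', y'⟩ hq
    simp only [Finset.coe_filter, Finset.mem_product, Set.mem_ofPred_eq] at hq
    simpa using ⟨hq.1.1.1, hq.1.2.1⟩

/-- splitting after a permutation -/
def vmSplit {D k : ℕ} (π : Equiv.Perm (Fin (D + k))) (z : Fin (D + k) → ℕ) : (Fin D → ℕ) × (Fin k → ℕ) :=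
  (fun i => z (π (Fin.castAdd k i)), fun i => z (π (Fin.natAdd D i)))

theorem vmSplit_inj {D k : ℕ} (π : Equiv.Perm (Fin (D + k))) : Function.Injective (vmSplit π) := by
  intro z w h
  have h1 : ∀ i : Fin (D + k), z (π i) = w (π i) := by
    intro i
    refine Fin.addCases (fun i => ?_) (fun i => ?_) i
    · exact congrFun (congrArg Prod.fst h) i
    · exact congrFun (congrArg Prod.snd h) i
  funext i
  simpa using h1 (π.symm i)

theorem vmSplit_ps {D k : ℕ} (E : ℕ) (π : Equiv.Perm (Fin (D + k))) (z : Fin (D + k) → ℕ) :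
    vmPS E (vmSplit π z).1 + vmPS E (vmSplit π z).2 = vmPS E z := by
  funext j
  have := Equiv.sum_comp π (fun i => (z i : ℤ) ^ (j.1 + 1))
  rw [Fin.sum_univ_add] at this
  simpa [vmPS, vmSplit] using this

theorem vmJ_add_le (E D k P : ℕ) :
    vmJ E (D + k) (Finset.range P) ≤ P ^ (2 * D) * vmJ E k (Finset.range P) := by
  have h1 : vmJ E (D + k) (Finset.range P) ≤
     vmE (Fintype.piFinset (fun _ : Fin D => Finset.range P) ×ˢ Fintype.piFinset (fun _ : Fin k => Finset.range P))
      (fun q => vmPS E q.1 + vmPS E q.2) := by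
    apply vmE_le_of_inj _ _ _ _ (vmSplit 1) _ (vmSplit_inj 1) (fun z _ => vmSplit_ps E 1 z)
    intro z hz
    simp only [Fintype.mem_piFinset, Finset.mem_product, vmSplit] at hz ⊢
    exact ⟨fun i => hz _, fun i => hz _⟩
  refine h1.trans ((vmE_prod_le _ _ _ _).trans (le_of_eq ?_))
  rw [Fintype.card_piFinset]
  simp only [Finset.card_range, Finset.prod_const, Finset.card_univ, Fintype.card_fin, vmJ]
  rw [← pow_mul, mul_comm D 2]

theorem vm_sum_le {ι : Type*} (s : Finset ι) (f : ι → ℕ) (B : ℕ) (h : ∀ c ∈ s, f c ≤ B) :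
    ∑ c ∈ s, f c ≤ s.card * B := by
  simpa using Finset.sum_le_card_nsmul s f B h

theorem vm_bad_one {D K l P : ℕ} (hK : 1 ≤ K) (s : Finset ℕ) (hs : s ⊆ Finset.range l) (hl : 0 < l) :
    vmJ D K (s.biUnion (fun c => (Finset.range (l * P)).filter (fun v => v % l = c)))
      ≤ s.card ^ (2 * K) * vmJ D K (Finset.range P) := by
  classical
  have h := vmE_holder (D := D) ({()} : Finset Unit) (fun _ => 0) s
    (fun c => (Finset.range (l * P)).filter (fun v => v % l = c)) (by
      intro a _ b _ hab
      rw [Function.onFun, Finset.disjoint_left]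
      intro v hv hv'
      rw [Finset.mem_filter] at hv hv'
      exact hab (hv.2.symm.trans hv'.2)) K hK
  have h1 : ∀ V : Finset ℕ, vmJ D K V ≤ vmE (({()} : Finset Unit) ×ˢ Fintype.piFinset (fun _ : Fin K => V))
      (fun q => (0 : Fin D → ℤ) + vmPS D q.2) := by
    intro V
    apply vmE_le_of_inj _ _ _ _ (fun z => ((), z))
    · intro z hz
      simpa using hz
    · intro a b hab
      simpa using hab
    · intro z _
      simp
  have h2 : ∀ V : Finset ℕ, vmE (({()} : Finset Unit) ×ˢ Fintype.piFinset (fun _ : Fin K => V))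
      (fun q => (0 : Fin D → ℤ) + vmPS D q.2) ≤ vmJ D K V := by
    intro V
    apply vmE_le_of_inj _ _ _ _ Prod.snd
    · intro z hz
      simpa using hz
    · intro a b hab
      exact Prod.ext rfl hab
    · intro z _
      simp
  refine (h1 _).trans (h.trans ?_)
  have e : 2 * K = 2 * K - 1 + 1 := by omega
  nth_rewrite 2 [e]
  rw [pow_succ, mul_assoc]
  apply Nat.mul_le_mul_left
  apply vm_sum_le
  intro c hc
  refine (h2 _).trans ?_
  rw [vm_class_eq l P c (Finset.mem_range.1 (hs hc))]
  exact vmJ_image _ _ _ _ _ hl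

theorem vm_good_one {p D k P : ℕ} [hp : Fact p.Prime] (hpD : D < p) (hD : 1 ≤ D) (hP : p * P ≤ p ^ D) (hk : 1 ≤ k)
    (X : Finset (Fin D → ℕ)) (hX1 : ∀ x ∈ X, ∀ i, x i < p * P)
    (hX2 : ∀ x ∈ X, Function.Injective (fun i => x i % p)) :
    vmE (X ×ˢ Fintype.piFinset (fun _ : Fin k => Finset.range (p * P)))
      (fun q => vmPS D q.1 + vmPS D q.2)
      ≤ p ^ (2 * k) * (((p * P) ^ D * (D ^ D * p ^ (D * (D - 1) / 2))) * vmJ D k (Finset.range P)) := by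
  classical
  have hU : Finset.range (p * P) = (Finset.range p).biUnion
      (fun c => (Finset.range (p * P)).filter (fun v => v % p = c)) := by
    ext v
    simp only [Finset.mem_biUnion, Finset.mem_filter, Finset.mem_range]
    constructor
    · intro h
      exact ⟨v % p, Nat.mod_lt _ hp.out.pos, h, rfl⟩
    · rintro ⟨c, _, h, _⟩
      exact h
  rw [hU]
  have h := vmE_holder (D := D) X (vmPS D) (Finset.range p)
    (fun c => (Finset.range (p * P)).filter (fun v => v % p = c)) (by
      intro a _ b _ hab
      rw [Function.onFun, Finset.disjoint_left]
      intro v hv hv'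
      rw [Finset.mem_filter] at hv hv'
      exact hab (hv.2.symm.trans hv'.2)) k hk
  refine h.trans ?_
  rw [Finset.card_range]
  have e : 2 * k = 2 * k - 1 + 1 := by omega
  nth_rewrite 2 [e]
  rw [pow_succ, mul_assoc]
  apply Nat.mul_le_mul_left
  refine (vm_sum_le _ _ ((p * P) ^ D * (D ^ D * p ^ (D * (D - 1) / 2)) * vmJ D k (Finset.range P)) ?_).trans
    (by rw [Finset.card_range])
  intro c hc
  rw [vm_class_eq p P c (Finset.mem_range.1 hc)]
  exact vm_mixed hpD hD hP c X hX1 hX2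

theorem vm_extend_perm {D K : ℕ} (a b : Fin D → Fin K) (ha : Function.Injective a) (hb : Function.Injective b) :
    ∃ π : Equiv.Perm (Fin K), ∀ i, π (a i) = b i := by
  classical
  let e : {x // x ∈ Set.range a} ≃ {x // x ∈ Set.range b} :=
    (Equiv.ofInjective a ha).symm.trans (Equiv.ofInjective b hb)
  refine ⟨e.extendSubtype, fun i => ?_⟩
  rw [Equiv.extendSubtype_apply_of_mem e (a i) ⟨i, rfl⟩]
  have : (Equiv.ofInjective a ha).symm ⟨a i, ⟨i, rfl⟩⟩ = i := by
    rw [Equiv.symm_apply_eq]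
    rfl
  simp [e, this]

theorem vm_step {p D k P : ℕ} [hp : Fact p.Prime] (hpD : D < p) (hD : 1 ≤ D) (hP : P ≤ p ^ (D - 1))
    (hk : D ^ 2 ≤ k) :
    vmJ D (D + k) (Finset.range (p * P)) ≤
      4 * (D + k) ^ (3 * (D + k)) * (p ^ (2 * k + D * (D - 1) / 2) * (p * P) ^ D * vmJ D k (Finset.range P)) := by
  classical
  have hk1 : 1 ≤ k := by nlinarith
  have hP' : p * P ≤ p ^ D := by
    calc p * P ≤ p * p ^ (D - 1) := Nat.mul_le_mul_left _ hP
      _ = p ^ D := by rw [← pow_succ', Nat.sub_add_cancel hD]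
  set K := D + k with hKdef
  set Z := Fintype.piFinset (fun _ : Fin (D + k) => Finset.range (p * P)) with hZ
  let cl : ℕ → Finset ℕ := fun c => (Finset.range (p * P)).filter (fun v => v % p = c)
  let X := (Fintype.piFinset (fun _ : Fin D => Finset.range (p * P))).filter
    (fun x => Function.Injective (fun i => x i % p))
  let Wb : Finset ℕ → Finset (Fin (D + k) → ℕ) := fun s => Fintype.piFinset (fun _ => s.biUnion cl)
  let Wg : Equiv.Perm (Fin (D + k)) → Finset (Fin (D + k) → ℕ) := fun π =>
    Z.filter (fun z => Function.Injective (fun i : Fin D => z (π (Fin.castAdd k i)) % p))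
  let B := Z.filter (fun z => (Finset.univ.image (fun i => z i % p)).card < D)
  let Gd := Z.filter (fun z => D ≤ (Finset.univ.image (fun i => z i % p)).card)
  have h0 : vmE Z (vmPS D) ≤ 2 * vmE B (vmPS D) + 2 * vmE Gd (vmPS D) := by
    apply vmE_cover_two
    intro z hz
    rcases Nat.lt_or_ge (Finset.univ.image (fun i => z i % p)).card D with h | h
    · left
      exact Finset.mem_filter.2 ⟨hz, h⟩
    · right
      exact Finset.mem_filter.2 ⟨hz, h⟩
  have hB : vmE B (vmPS D) ≤ p ^ (D - 1) * (p ^ (D - 1) * (D ^ (2 * K) * (P ^ (2 * D) * vmJ D k (Finset.range P)))) := by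
    refine (vmE_cover B (vmPS D) (Finset.powersetCard (D - 1) (Finset.range p)) Wb ?_).trans ?_
    · intro z hz
      rw [Finset.mem_filter] at hz
      obtain ⟨hz, hc⟩ := hz
      obtain ⟨t, ht1, ht2, ht3⟩ := Finset.exists_subsuperset_card_eq
        (s := Finset.univ.image (fun i => z i % p)) (t := Finset.range p) (n := D - 1) (by
          intro c hc
          obtain ⟨i, _, rfl⟩ := Finset.mem_image.1 hc
          exact Finset.mem_range.2 (Nat.mod_lt _ hp.out.pos)) (by omega) (by rw [Finset.card_range]; omega)
      refine ⟨t, Finset.mem_powersetCard.2 ⟨ht2, ht3⟩, ?_⟩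
      rw [Fintype.mem_piFinset]
      intro i
      rw [hZ, Fintype.mem_piFinset] at hz
      exact Finset.mem_biUnion.2 ⟨z i % p, ht1 (Finset.mem_image_of_mem _ (Finset.mem_univ i)),
        Finset.mem_filter.2 ⟨hz i, rfl⟩⟩
    · have hcc : (Finset.powersetCard (D - 1) (Finset.range p)).card ≤ p ^ (D - 1) := by
        rw [Finset.card_powersetCard, Finset.card_range]
        exact Nat.choose_le_pow _ _
      refine Nat.mul_le_mul hcc ?_
      refine (vm_sum_le _ _ (D ^ (2 * K) * (P ^ (2 * D) * vmJ D k (Finset.range P))) ?_).trans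
        (Nat.mul_le_mul_right _ hcc)
      intro s hs
      rw [Finset.mem_powersetCard] at hs
      refine (vm_bad_one (D := D) (K := D + k) (l := p) (P := P) (by omega) s hs.1 hp.out.pos).trans ?_
      apply Nat.mul_le_mul
      · exact Nat.pow_le_pow_left (by omega) _
      · exact vmJ_add_le D D k P
  have hG : vmE Gd (vmPS D) ≤ K.factorial * (K.factorial * (p ^ (2 * k) * (((p * P) ^ D * (D ^ D * p ^ (D * (D - 1) / 2))) * vmJ D k (Finset.range P)))) := by
    refine (vmE_cover Gd (vmPS D) Finset.univ Wg ?_).trans ?_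
    · intro z hz
      rw [Finset.mem_filter] at hz
      obtain ⟨hz, hc⟩ := hz
      obtain ⟨t, ht1, ht2⟩ := Finset.exists_subset_card_eq hc
      have hex : ∀ c : t, ∃ i, z i % p = c := by
        rintro ⟨c, hc⟩
        obtain ⟨i, _, hi⟩ := Finset.mem_image.1 (ht1 hc)
        exact ⟨i, hi⟩
      choose f hf using hex
      let e : Fin D ≃ t := (Finset.equivFinOfCardEq ht2).symm
      have hinj : Function.Injective (fun i => z (f (e i)) % p) := by
        intro i j hij
        simp only [hf] at hij
        exact e.injective (Subtype.ext hij)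
      obtain ⟨π, hπ⟩ := vm_extend_perm (fun i : Fin D => Fin.castAdd k i) (fun i => f (e i))
        (Fin.castAdd_injective D k) (by
          intro i j hij
          apply hinj
          simp only at hij ⊢
          rw [hij])
      refine ⟨π, Finset.mem_univ _, Finset.mem_filter.2 ⟨hz, ?_⟩⟩
      simp only [hπ]
      exact hinj
    · have hcc : (Finset.univ : Finset (Equiv.Perm (Fin (D + k)))).card = K.factorial := by
        rw [Finset.card_univ, Fintype.card_perm, Fintype.card_fin]
      rw [hcc]
      apply Nat.mul_le_mul_left
      refine (vm_sum_le _ _ (p ^ (2 * k) * (((p * P) ^ D * (D ^ D * p ^ (D * (D - 1) / 2))) * vmJ D k (Finset.range P))) ?_).trans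
        (by rw [hcc])
      intro π _
      refine le_trans ?_ (vm_good_one hpD hD hP' hk1 X ?_ ?_)
      · apply vmE_le_of_inj _ _ _ _ (vmSplit π) _ (vmSplit_inj π) (fun z _ => vmSplit_ps D π z)
        intro z hz
        rw [Finset.mem_filter, hZ, Fintype.mem_piFinset] at hz
        rw [Finset.mem_product, Finset.mem_filter, Fintype.mem_piFinset, Fintype.mem_piFinset]
        exact ⟨⟨fun i => hz.1 _, hz.2⟩, fun i => hz.1 _⟩
      · intro x hx i
        rw [Finset.mem_filter, Fintype.mem_piFinset] at hx
        exact Finset.mem_range.1 (hx.1 i)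
      · intro x hx
        exact (Finset.mem_filter.1 hx).2
  have hK1 : 1 ≤ K := by omega
  have f1 : K.factorial ≤ K ^ K := Nat.factorial_le_pow K
  have f2 : D ^ (2 * K) ≤ K ^ (3 * K) :=
    (Nat.pow_le_pow_left (by omega) _).trans (Nat.pow_le_pow_right hK1 (by omega))
  have f3 : D ^ D ≤ K ^ K := (Nat.pow_le_pow_left (by omega) _).trans (Nat.pow_le_pow_right hK1 (by omega))
  set J := vmJ D k (Finset.range P)
  set T := p ^ (2 * k + D * (D - 1) / 2) * (p * P) ^ D * J with hT
  have g1 : p ^ (D - 1) * (p ^ (D - 1) * (D ^ (2 * K) * (P ^ (2 * D) * J))) ≤ K ^ (3 * K) * T := by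
    have a1 : P ^ D ≤ p ^ ((D - 1) * D) := by
      rw [pow_mul]
      exact Nat.pow_le_pow_left hP _
    calc p ^ (D - 1) * (p ^ (D - 1) * (D ^ (2 * K) * (P ^ (2 * D) * J)))
        = D ^ (2 * K) * (p ^ (2 * (D - 1)) * (P ^ D) * P ^ D * J) := by ring
      _ ≤ K ^ (3 * K) * (p ^ (2 * (D - 1)) * p ^ ((D - 1) * D) * P ^ D * J) := by gcongr
      _ = K ^ (3 * K) * (p ^ (2 * (D - 1) + (D - 1) * D) * P ^ D * J) := by rw [pow_add]
      _ ≤ K ^ (3 * K) * (p ^ (2 * k + D * (D - 1) / 2 + D) * P ^ D * J) := by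
          have hexp : 2 * (D - 1) + (D - 1) * D ≤ 2 * k + D * (D - 1) / 2 + D := by
            have q0 : 2 * (D - 1) + (D - 1) * D ≤ 2 * k := by
              obtain ⟨d, hd⟩ : ∃ d, D = d + 1 := ⟨D - 1, by omega⟩
              rw [hd] at hk ⊢
              simp only [Nat.add_sub_cancel]
              nlinarith
            omega
          have := Nat.pow_le_pow_right hp.out.pos hexp
          gcongr
      _ = _ := by
          rw [hT]
          ring
  have g2 : K.factorial * (K.factorial * (p ^ (2 * k) * (((p * P) ^ D * (D ^ D * p ^ (D * (D - 1) / 2))) * J))) ≤ K ^ (3 * K) * T := by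
    calc _ ≤ K ^ K * (K ^ K * (p ^ (2 * k) * (((p * P) ^ D * (K ^ K * p ^ (D * (D - 1) / 2))) * J))) := by gcongr
      _ = _ := by
        rw [hT]
        ring
  have : vmJ D (D + k) (Finset.range (p * P)) = vmE Z (vmPS D) := rfl
  rw [this]
  have h3 := hB.trans g1
  have h4 := hG.trans g2
  calc _ ≤ _ := h0
    _ ≤ 4 * (K ^ (3 * K) * T) := by omega
    _ = _ := by ring


theorem vm_prime_exists (D P : ℕ) (hD : 2 ≤ D) (hP : D ^ (D - 1) < P) :
    ∃ p : ℕ, p.Prime ∧ D < p ∧ P ≤ p ^ (D - 1) ∧ p ^ (D - 1) ≤ 4 ^ (D - 1) * P := by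
  classical
  have hex : ∃ x, P ≤ x ^ (D - 1) := ⟨P, Nat.le_self_pow (by omega) P⟩
  set x := Nat.find hex with hx
  have h1 : P ≤ x ^ (D - 1) := Nat.find_spec hex
  have h2 : D < x := by
    by_contra h
    have := Nat.pow_le_pow_left (not_lt.1 h) (D - 1)
    omega
  have h3 : (x - 1) ^ (D - 1) < P := by
    by_contra h
    have := Nat.find_min' hex (not_lt.1 h)
    omega
  obtain ⟨p, hp, hp1, hp2⟩ := Nat.exists_prime_lt_and_le_two_mul x (by omega)
  refine ⟨p, hp, by omega, h1.trans (Nat.pow_le_pow_left hp1.le _), ?_⟩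
  calc p ^ (D - 1) ≤ (4 * (x - 1)) ^ (D - 1) := Nat.pow_le_pow_left (by omega) _
    _ = 4 ^ (D - 1) * (x - 1) ^ (D - 1) := by rw [mul_pow]
    _ ≤ _ := Nat.mul_le_mul_left _ h3.le

theorem vm_iter (D P0 M : ℕ) (hD : 2 ≤ D) (hP : D ^ (D - 1) < P0) (l : ℕ) (hM : D ^ 2 + l * D ≤ M) :
    ∃ P : ℕ, P0 ≤ P ∧ ((D : ℝ) / (D - 1)) ^ l * Real.logb 2 P0 ≤ Real.logb 2 P ∧
      Real.logb 2 P ≤ ((D : ℝ) / (D - 1)) ^ l * (Real.logb 2 P0 + 2 * l) ∧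
      vmJ D (D ^ 2 + l * D) (Finset.range P) * P ^ (D * (D + 1) / 2)
        ≤ (4 * M ^ (3 * M) * 4 ^ (D ^ 2)) ^ l * P0 ^ (D * (D + 1) / 2) * P ^ (2 * (D ^ 2 + l * D)) := by
  have hP0 : 0 < P0 := by omega
  have hD1 : (1 : ℝ) < D := by exact_mod_cast hD
  induction l with
  | zero =>
    refine ⟨P0, le_refl _, by simp, by simp, ?_⟩
    have : vmJ D (D ^ 2 + 0 * D) (Finset.range P0) ≤ P0 ^ (2 * (D ^ 2 + 0 * D)) := by
      have := vmJ_add_le D (D ^ 2 + 0 * D) 0 P0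
      refine this.trans ?_
      have h1 : vmJ D 0 (Finset.range P0) ≤ 1 := by
        unfold vmJ vmE
        refine (Finset.card_filter_le _ _).trans ?_
        simp
      exact (Nat.mul_le_mul_left _ h1).trans (by simp)
    calc _ ≤ P0 ^ (2 * (D ^ 2 + 0 * D)) * P0 ^ (D * (D + 1) / 2) := Nat.mul_le_mul_right _ this
      _ = _ := by ring
  | succ l ih =>
    obtain ⟨P, h1, h2, h3, h4⟩ := ih (by nlinarith)
    obtain ⟨p, hp, hpD, hp1, hp2⟩ := vm_prime_exists D P hD (by omega)
    have hp' : Fact p.Prime := ⟨hp⟩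
    have hPpos : 0 < P := by omega
    have hPR : (0 : ℝ) < P := by exact_mod_cast hPpos
    have hpR : (0 : ℝ) < p := by exact_mod_cast hp.pos
    have hρ : (0 : ℝ) < (D : ℝ) / (D - 1) := by
      apply div_pos <;> linarith
    have hlog : Real.logb 2 ((p * P : ℕ) : ℝ) = Real.logb 2 p + Real.logb 2 P := by
      push_cast
      exact Real.logb_mul hpR.ne' hPR.ne'
    have l1 : Real.logb 2 P ≤ (D - 1) * Real.logb 2 p := by
      have : (P : ℝ) ≤ (p : ℝ) ^ (D - 1) := by exact_mod_cast hp1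
      have := Real.logb_le_logb_of_le (b := 2) (by norm_num) hPR this
      rw [Real.logb_pow] at this
      rwa [Nat.cast_sub (by omega), Nat.cast_one] at this
    have l2 : (D - 1) * Real.logb 2 p ≤ (D - 1) * 2 + Real.logb 2 P := by
      have : (p : ℝ) ^ (D - 1) ≤ 4 ^ (D - 1) * (P : ℝ) := by exact_mod_cast hp2
      have := Real.logb_le_logb_of_le (b := 2) (by norm_num) (by positivity) this
      rw [Real.logb_pow, Real.logb_mul (by positivity) hPR.ne', Real.logb_pow,
        show (4 : ℝ) = 2 ^ (2 : ℕ) by norm_num, Real.logb_pow, Real.logb_self_eq_one (by norm_num)] at this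
      rw [Nat.cast_sub (by omega), Nat.cast_one] at this
      push_cast at this
      linarith
    have hDm : (0 : ℝ) < (D : ℝ) - 1 := by linarith
    have e1 : (D : ℝ) / (D - 1) * Real.logb 2 P ≤ Real.logb 2 p + Real.logb 2 P := by
      rw [div_mul_eq_mul_div, div_le_iff₀ hDm]
      nlinarith
    have e2 : Real.logb 2 p + Real.logb 2 P ≤ (D : ℝ) / (D - 1) * Real.logb 2 P + 2 := by
      have : (D : ℝ) / (D - 1) * Real.logb 2 P = Real.logb 2 P + Real.logb 2 P / (D - 1) := by
        field_simp
        ring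
      rw [this]
      have : Real.logb 2 p ≤ 2 + Real.logb 2 P / (D - 1) := by
        rw [← sub_le_iff_le_add', le_div_iff₀ hDm]
        linarith
      linarith
    refine ⟨p * P, h1.trans (Nat.le_mul_of_pos_left _ hp.pos), ?_, ?_, ?_⟩
    · rw [hlog, pow_succ, mul_comm (_ ^ l), mul_assoc]
      exact (mul_le_mul_of_nonneg_left h2 hρ.le).trans e1
    · rw [hlog]
      refine e2.trans ?_
      have := mul_le_mul_of_nonneg_left h3 hρ.le
      have h1p : (1 : ℝ) ≤ ((D : ℝ) / (D - 1)) ^ (l + 1) := by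
        apply one_le_pow₀
        rw [le_div_iff₀ hDm]
        linarith
      rw [pow_succ] at h1p ⊢
      push_cast
      nlinarith
    · have hk : D ^ 2 ≤ D ^ 2 + l * D := by omega
      have hst := vm_step hpD (by omega) hp1 hk
      set k := D ^ 2 + l * D with hkd
      have ek : D ^ 2 + (l + 1) * D = D + k := by rw [hkd]; ring
      rw [ek] at hM ⊢
      have hC : (D + k) ^ (3 * (D + k)) ≤ M ^ (3 * M) :=
        (Nat.pow_le_pow_left hM _).trans (Nat.pow_le_pow_right (by omega) (by omega))
      set C := M ^ (3 * M)
      set J := vmJ D k (Finset.range P)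
      set d := D * (D + 1) / 2 with hd
      have hdd : 2 * d = D * (D + 1) := Nat.mul_div_cancel' (Nat.even_mul_succ_self D).two_dvd
      set d' := D * (D - 1) / 2 with hd'
      have hdd' : 2 * d' = D * (D - 1) := Nat.mul_div_cancel' (Nat.even_mul_pred_self D).two_dvd
      have hsum : d' + D + d = 2 * D + (D - 1) * D := by
        obtain ⟨m, rfl⟩ : ∃ m, D = m + 1 := ⟨D - 1, by omega⟩
        simp only [Nat.add_sub_cancel] at hdd' ⊢
        nlinarith
      have hpp : p ^ ((D - 1) * D) ≤ 4 ^ (D ^ 2) * P ^ D := by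
        calc p ^ ((D - 1) * D) = (p ^ (D - 1)) ^ D := by rw [pow_mul]
          _ ≤ (4 ^ (D - 1) * P) ^ D := Nat.pow_le_pow_left hp2 _
          _ = 4 ^ ((D - 1) * D) * P ^ D := by rw [mul_pow, pow_mul]
          _ ≤ _ := by
            apply Nat.mul_le_mul_right
            apply Nat.pow_le_pow_right (by norm_num)
            rw [sq]
            exact Nat.mul_le_mul_right _ (by omega)
      set A := (4 * C * 4 ^ (D ^ 2)) ^ l with hA
      calc vmJ D (D + k) (Finset.range (p * P)) * (p * P) ^ d
          ≤ 4 * C * (p ^ (2 * k + d') * (p * P) ^ D * J) * (p * P) ^ d := by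
            apply Nat.mul_le_mul_right
            refine hst.trans ?_
            gcongr
        _ = 4 * C * (p ^ (2 * k) * p ^ (d' + D + d) * P ^ D) * (J * P ^ d) := by ring
        _ ≤ 4 * C * (p ^ (2 * k) * p ^ (d' + D + d) * P ^ D) * (A * P0 ^ d * P ^ (2 * k)) := by gcongr
        _ = 4 * C * (p ^ (2 * k) * p ^ (2 * D) * p ^ ((D - 1) * D) * P ^ D) * (A * P0 ^ d * P ^ (2 * k)) := by
            rw [hsum]; ring
        _ ≤ 4 * C * (p ^ (2 * k) * p ^ (2 * D) * (4 ^ (D ^ 2) * P ^ D) * P ^ D) * (A * P0 ^ d * P ^ (2 * k)) := by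
            gcongr
        _ = _ := by
            rw [pow_succ _ l, ← hA]
            ring


theorem vm_rho (D : ℕ) (hD : 2 ≤ D) :
    (1024 : ℝ) ≤ ((D : ℝ) / (D - 1)) ^ (10 * (D - 1)) ∧ ((D : ℝ) / (D - 1)) ^ (10 * (D - 1)) ≤ 59049 := by
  obtain ⟨d, rfl⟩ : ∃ d, D = d + 1 := ⟨D - 1, by omega⟩
  have hd : (0 : ℝ) < d := by exact_mod_cast (by omega : 0 < d)
  have e : (((d + 1 : ℕ) : ℝ) / ((d + 1 : ℕ) - 1)) = 1 + 1 / d := by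
    push_cast
    rw [add_sub_cancel_right, add_div, div_self hd.ne']
  rw [e, Nat.add_sub_cancel, mul_comm 10 d, pow_mul]
  have h1 : (2 : ℝ) ≤ (1 + 1 / (d : ℝ)) ^ d := by
    have h0 : 0 < 1 / (d : ℝ) := by positivity
    have := one_add_mul_le_pow (a := 1 / (d : ℝ)) (by linarith) d
    rw [mul_one_div_cancel hd.ne'] at this
    linarith
  have h2 : (1 + 1 / (d : ℝ)) ^ d ≤ 3 := by
    calc (1 + 1 / (d : ℝ)) ^ d ≤ (Real.exp (1 / d)) ^ d := by
          gcongr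
          have := Real.add_one_le_exp (1 / (d : ℝ))
          linarith
      _ = Real.exp 1 := by
          rw [← Real.exp_nat_mul, mul_one_div_cancel hd.ne']
      _ ≤ 3 := by
          have := Real.exp_one_lt_d9
          linarith
  constructor
  · calc (1024 : ℝ) = 2 ^ 10 := by norm_num
      _ ≤ _ := by gcongr
  · calc _ ≤ (3 : ℝ) ^ 10 := by gcongr
      _ = _ := by norm_num

theorem vm_mvt (D h lam : ℕ) (hD : 2 ≤ D) (hlam : 1 ≤ lam) (hl : 11 * D ^ 2 ≤ 2 ^ lam)
    (hh : 10 ^ 8 * lam * D ≤ h) :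
    ∃ P k b0 : ℕ, 0 < P ∧ 0 < k ∧ k ≤ 11 * D ^ 2 ∧ 2800 * b0 ≤ h ∧ 0.35 * (h : ℝ) ≤ Real.logb 2 P ∧
      Real.logb 2 P ≤ 0.4 * (h : ℝ) ∧
      vmJ D k (Finset.range P) * P ^ (D * (D + 1) / 2)
        ≤ 2 ^ (370 * lam * D ^ 3 + b0 * (D * (D + 1) / 2)) * P ^ (2 * k) := by
  obtain ⟨r1, r2⟩ := vm_rho D hD
  set ϱ := ((D : ℝ) / (D - 1)) ^ (10 * (D - 1)) with hϱ
  have hϱ0 : 0 < ϱ := by linarith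
  set b0 := ⌊0.36 * (h : ℝ) / ϱ⌋₊ with hb0
  have hhR : (10 : ℝ) ^ 8 * lam * D ≤ h := by exact_mod_cast hh
  have hlR : (1 : ℝ) ≤ lam := by exact_mod_cast hlam
  have hDR : (2 : ℝ) ≤ D := by exact_mod_cast hD
  have hld : (2 : ℝ) ≤ lam * D := by nlinarith
  have b1 : (b0 : ℝ) ≤ 0.36 * (h : ℝ) / ϱ := Nat.floor_le (by positivity)
  have b2 : 0.36 * (h : ℝ) / ϱ < b0 + 1 := Nat.lt_floor_add_one _
  have b1' : (b0 : ℝ) * ϱ ≤ 0.36 * h := by rwa [le_div_iff₀ hϱ0] at b1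
  have b2' : 0.36 * (h : ℝ) < (b0 + 1) * ϱ := by rwa [div_lt_iff₀ hϱ0] at b2
  have b3 : (lam * D : ℝ) ≤ b0 := by
    have : 0.36 * (h : ℝ) < (b0 + 1) * 59049 := b2'.trans_le (by gcongr)
    nlinarith
  have b3' : lam * D ≤ b0 := by exact_mod_cast b3
  have hDl : D < 2 ^ lam := by nlinarith
  have hP : D ^ (D - 1) < 2 ^ b0 := by
    calc D ^ (D - 1) < (2 ^ lam) ^ (D - 1) := Nat.pow_lt_pow_left hDl (by omega)
      _ = 2 ^ (lam * (D - 1)) := by rw [pow_mul]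
      _ ≤ 2 ^ b0 := Nat.pow_le_pow_right (by norm_num) (le_trans (Nat.mul_le_mul_left _ (by omega)) b3')
  have hkk : D ^ 2 + 10 * (D - 1) * D ≤ 11 * D ^ 2 := by
    obtain ⟨d, rfl⟩ : ∃ d, D = d + 1 := ⟨D - 1, by omega⟩
    simp only [Nat.add_sub_cancel]
    nlinarith
  obtain ⟨P, p1, p2, p3, p4⟩ := vm_iter D (2 ^ b0) (11 * D ^ 2) hD hP (10 * (D - 1)) hkk
  have hlog : Real.logb 2 ((2 ^ b0 : ℕ) : ℝ) = b0 := by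
    push_cast
    rw [Real.logb_pow, Real.logb_self_eq_one (by norm_num), mul_one]
  rw [hlog, ← hϱ] at p2 p3
  refine ⟨P, D ^ 2 + 10 * (D - 1) * D, b0, lt_of_lt_of_le (by positivity) p1, by positivity, hkk, ?_, ?_, ?_, ?_⟩
  · have : (2800 : ℝ) * b0 ≤ h := by nlinarith
    exact_mod_cast this
  · nlinarith
  · refine p3.trans ?_
    have : (((10 * (D - 1) : ℕ) : ℝ)) ≤ 10 * D := by
      have : 10 * (D - 1) ≤ 10 * D := by omega
      exact_mod_cast this
    have t1 : ϱ * (2 * ((10 * (D - 1) : ℕ) : ℝ)) ≤ 59049 * (2 * (10 * D)) := by gcongr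
    have t2 : (D : ℝ) ≤ lam * D := by nlinarith
    rw [mul_add]
    nlinarith
  · refine p4.trans ?_
    apply Nat.mul_le_mul_right
    have c1 : 4 * (11 * D ^ 2) ^ (3 * (11 * D ^ 2)) * 4 ^ (D ^ 2) ≤ 2 ^ (37 * lam * D ^ 2) := by
      calc 4 * (11 * D ^ 2) ^ (3 * (11 * D ^ 2)) * 4 ^ (D ^ 2)
          ≤ 4 * (2 ^ lam) ^ (3 * (11 * D ^ 2)) * 4 ^ (D ^ 2) := by gcongr
        _ = 2 ^ (2 + lam * (3 * (11 * D ^ 2)) + 2 * D ^ 2) := by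
            rw [show 4 = 2 ^ 2 by norm_num, ← pow_mul, ← pow_mul, ← pow_add, ← pow_add]
        _ ≤ _ := by
            apply Nat.pow_le_pow_right (by norm_num)
            nlinarith [Nat.mul_le_mul hlam (le_refl (D ^ 2)), Nat.pow_le_pow_left hD 2]
    calc _ ≤ (2 ^ (37 * lam * D ^ 2)) ^ (10 * (D - 1)) * (2 ^ b0) ^ (D * (D + 1) / 2) := by gcongr
      _ = 2 ^ (37 * lam * D ^ 2 * (10 * (D - 1)) + b0 * (D * (D + 1) / 2)) := by
          rw [← pow_mul, ← pow_mul, ← pow_add]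
      _ ≤ _ := by
          apply Nat.pow_le_pow_right (by norm_num)
          apply Nat.add_le_add_right
          calc 37 * lam * D ^ 2 * (10 * (D - 1)) ≤ 37 * lam * D ^ 2 * (10 * D) := by
                apply Nat.mul_le_mul_left; omega
            _ = _ := by ring


/-- `e(x) = exp (2 π i x)` -/
noncomputable def vme (x : ℝ) : ℂ := Complex.exp (2 * Real.pi * Complex.I * x)

theorem vme_zero : vme 0 = 1 := by simp [vme]

theorem vme_add (x y : ℝ) : vme (x + y) = vme x * vme y := by
  rw [vme, vme, vme, ← Complex.exp_add]
  congr 1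
  push_cast
  ring

theorem vme_norm (x : ℝ) : ‖vme x‖ = 1 := by
  have : vme x = Complex.exp ((2 * Real.pi * x : ℝ) * Complex.I) := by
    rw [vme]
    congr 1
    push_cast
    ring
  rw [this, Complex.norm_exp_ofReal_mul_I]

theorem vme_eq_one_iff (x : ℝ) : vme x = 1 ↔ ∃ n : ℤ, x = n := by
  rw [vme, Complex.exp_eq_one_iff]
  constructor
  · rintro ⟨n, hn⟩
    refine ⟨n, ?_⟩
    have h : (2 * Real.pi * Complex.I : ℂ) ≠ 0 := Complex.two_pi_I_ne_zero
    have : (x : ℂ) = n := by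
      apply mul_left_cancel₀ h
      rw [hn]
      ring
    exact_mod_cast this
  · rintro ⟨n, hn⟩
    refine ⟨n, ?_⟩
    rw [hn]
    push_cast
    ring

theorem vme_int (n : ℤ) : vme n = 1 := (vme_eq_one_iff _).2 ⟨n, rfl⟩

theorem vme_conj (x : ℝ) : (starRingEnd ℂ) (vme x) = vme (-x) := by
  rw [vme, vme, ← Complex.exp_conj]
  congr 1
  have h2 : (starRingEnd ℂ) 2 = 2 := Complex.conj_ofNat 2
  simp [h2]

theorem vme_sum {ι : Type*} (s : Finset ι) (f : ι → ℝ) : vme (∑ i ∈ s, f i) = ∏ i ∈ s, vme (f i) := by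
  classical
  induction s using Finset.induction_on with
  | empty => simp [vme_zero]
  | insert a s ha ih => rw [Finset.sum_insert ha, Finset.prod_insert ha, vme_add, ih]

/-- pairing -/
noncomputable def vmP {D : ℕ} (α : Fin D → ℝ) (t : Fin D → ℤ) : ℝ := ∑ j, α j * t j

theorem vmP_add {D : ℕ} (α : Fin D → ℝ) (t s : Fin D → ℤ) : vmP α (t + s) = vmP α t + vmP α s := by
  simp [vmP, mul_add, Finset.sum_add_distrib]

theorem vmP_sum {D : ℕ} {ι : Type*} (S : Finset ι) (α : Fin D → ℝ) (t : ι → Fin D → ℤ) :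
    vmP α (∑ i ∈ S, t i) = ∑ i ∈ S, vmP α (t i) := by
  simp only [vmP, Finset.sum_apply, Int.cast_sum, Finset.mul_sum]
  exact Finset.sum_comm

theorem vm_expand {D : ℕ} (α : Fin D → ℝ) (V : Finset ℕ) (k : ℕ) :
    ((‖∑ v ∈ V, vme (vmP α (vmS D v))‖ ^ (2 * k) : ℝ) : ℂ) =
      ∑ q ∈ (Fintype.piFinset (fun _ : Fin k => V)) ×ˢ (Fintype.piFinset (fun _ : Fin k => V)),
        vme (vmP α (vmPS D q.1 - vmPS D q.2)) := by
  classical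
  have h1 : (∑ v ∈ V, vme (vmP α (vmS D v))) ^ k
      = ∑ v ∈ Fintype.piFinset (fun _ : Fin k => V), vme (vmP α (vmPS D v)) := by
    have : (∑ v ∈ V, vme (vmP α (vmS D v))) ^ k
      = ∑ v ∈ Fintype.piFinset (fun _ : Fin k => V), ∏ i, vme (vmP α (vmS D (v i))) := by
      rw [← Finset.prod_univ_sum (fun _ : Fin k => V) (fun _ v => vme (vmP α (vmS D v)))]
      simp
    rw [this]
    apply Finset.sum_congr rfl
    intro v _
    rw [vmPS_eq_sum, vmP_sum, vme_sum]
  rw [mul_comm, pow_mul, ← norm_pow, h1]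
  push_cast
  rw [← Complex.mul_conj', map_sum, Finset.sum_mul_sum, Finset.sum_product]
  refine Finset.sum_congr rfl fun x _ => Finset.sum_congr rfl fun y _ => ?_
  rw [vme_conj, ← vme_add]
  congr 1
  simp [vmP, mul_sub, Finset.sum_sub_distrib]
  ring

theorem vm_fiber {α Γ : Type*} [DecidableEq Γ] [AddCommGroup Γ] (Y : Finset α) (b : α → Γ) (T : Finset Γ)
    (hT : ∀ y ∈ Y, ∀ y' ∈ Y, b y - b y' ∈ T) (F : Γ → ℝ) (hF : ∀ t, 0 ≤ F t) :
    ∑ q ∈ Y ×ˢ Y, F (b q.1 - b q.2) ≤ vmE Y b * ∑ t ∈ T, F t := by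
  rw [← Finset.sum_fiberwise_of_maps_to (s := Y ×ˢ Y) (t := T) (g := fun q => b q.1 - b q.2)
    (fun q hq => hT _ (Finset.mem_product.1 hq).1 _ (Finset.mem_product.1 hq).2), Finset.mul_sum]
  apply Finset.sum_le_sum
  intro t _
  rw [Finset.sum_congr rfl (g := fun _ => F t) (by
    intro q hq
    rw [(Finset.mem_filter.1 hq).2])]
  rw [Finset.sum_const, nsmul_eq_mul]
  apply mul_le_mul_of_nonneg_right _ (hF t)
  have := vmE_shift Y b 0 t
  have e : (Y ×ˢ Y).filter (fun q => b q.1 - b q.2 = t) = (Y ×ˢ Y).filter (fun q => 0 + b q.1 = t + b q.2) := by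
    apply Finset.filter_congr
    intro q _
    rw [zero_add, sub_eq_iff_eq_add]
  rw [e]
  exact_mod_cast this

theorem vm_geom (A : ℝ) (R q : ℕ) (hR : 1 ≤ R) (n : ℤ)
    (hA : R = 1 ∨ ((∃ z : ℤ, A * R = z) ∧ ∀ d : ℤ, (∃ z : ℤ, A * d = z) → (R : ℤ) ∣ d)) :
    ‖∑ m ∈ Finset.Ico (-(q * R : ℤ)) (q * R), vme (A * m * n)‖ ≤ if (R : ℤ) ∣ n then (2 * q * R : ℝ) else 0 := by
  split_ifs with hd
  · refine (norm_sum_le _ _).trans ?_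
    simp only [vme_norm, Finset.sum_const, Int.card_Ico, nsmul_eq_mul, mul_one]
    have : (((q * R : ℤ) - -(q * R : ℤ)).toNat : ℝ) = 2 * q * R := by
      have h : ((q * R : ℤ) - -(q * R : ℤ)).toNat = 2 * q * R := by
        zify
        have h0 : (0 : ℤ) ≤ q * R := by positivity
        rw [Int.toNat_of_nonneg (by linarith)]
        ring
      rw [h]
      push_cast
      ring
    rw [this]
  · rcases hA with h1 | ⟨⟨z, hz⟩, h2⟩
    · exact absurd (by rw [h1]; simp) hd
    · have hne : vme (A * n) ≠ 1 := by
        intro h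
        exact hd (h2 n ((vme_eq_one_iff _).1 h))
      set S := ∑ m ∈ Finset.Ico (-(q * R : ℤ)) (q * R), vme (A * m * n) with hS
      have key : S * vme (A * n) = S := by
        have s1 : S * vme (A * n) = ∑ m ∈ Finset.Ico (-(q * R : ℤ) + 1) (q * R + 1), vme (A * m * n) := by
          rw [hS, Finset.sum_mul, ← Finset.sum_Ico_add_right_sub_eq (c := (1 : ℤ))]
          apply Finset.sum_congr rfl
          intro m _
          rw [← vme_add]
          congr 1
          push_cast
          ring
        rw [s1, hS]
        rcases Nat.eq_zero_or_pos q with rfl | hq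
        · simp
        have hqR : (0 : ℤ) < q * R := by positivity
        have t1 : Finset.Ico (-(q * R : ℤ) + 1) (q * R + 1) = insert (q * R : ℤ) (Finset.Ico (-(q * R : ℤ) + 1) (q * R)) := by
          ext m
          simp only [Finset.mem_Ico, Finset.mem_insert]
          omega
        have t2 : Finset.Ico (-(q * R : ℤ)) (q * R) = insert (-(q * R) : ℤ) (Finset.Ico (-(q * R : ℤ) + 1) (q * R)) := by
          ext m
          simp only [Finset.mem_Ico, Finset.mem_insert]
          omega
        rw [t1, t2, Finset.sum_insert (by simp), Finset.sum_insert (by simp)]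
        congr 1
        have u1 : vme (A * ((q * R : ℤ) : ℝ) * n) = 1 := by
          rw [vme_eq_one_iff]
          refine ⟨z * q * n, ?_⟩
          push_cast
          rw [← hz]
          ring
        have u2 : vme (A * ((-(q * R) : ℤ) : ℝ) * n) = 1 := by
          rw [vme_eq_one_iff]
          refine ⟨-(z * q * n), ?_⟩
          push_cast
          rw [← hz]
          ring
        rw [u1, u2]
      have : S = 0 := by
        by_contra h0
        apply hne
        apply mul_left_cancel₀ h0
        rw [key, mul_one]
      rw [this]
      simp


theorem vm_ps_bound {D k P : ℕ} (y y' : Fin k → ℕ) (hy : ∀ i, y i < P) (hy' : ∀ i, y' i < P) (j : Fin D) :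
    |(vmPS D y - vmPS D y') j| ≤ (k * P ^ (j.1 + 1) : ℤ) := by
  have h : ∀ z : Fin k → ℕ, (∀ i, z i < P) → 0 ≤ vmPS D z j ∧ vmPS D z j ≤ (k * P ^ (j.1 + 1) : ℤ) := by
    intro z hz
    constructor
    · exact Finset.sum_nonneg fun i _ => by positivity
    · have : vmPS D z j ≤ ∑ i : Fin k, (P : ℤ) ^ (j.1 + 1) := by
        apply Finset.sum_le_sum
        intro i _
        have : (z i : ℤ) ≤ P := by exact_mod_cast (hz i).le
        gcongr
      simpa using this
  have h1 := h y hy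
  have h2 := h y' hy'
  rw [Pi.sub_apply, abs_le]
  constructor <;> linarith [h1.1, h1.2, h2.1, h2.2]

/-- Count of the second kind. -/
theorem vm_box_sum {D k P : ℕ} (A : Fin D → ℝ) (R q : Fin D → ℕ) (hR : ∀ j, 1 ≤ R j)
    (hq : ∀ j, k * P ^ (j.1 + 1) < q j * R j)
    (hA : ∀ j, R j = 1 ∨ ((∃ z : ℤ, A j * R j = z) ∧ ∀ d : ℤ, (∃ z : ℤ, A j * d = z) → (R j : ℤ) ∣ d)) :
    ∑ m ∈ Fintype.piFinset (fun j => Finset.Ico (-(q j * R j : ℤ)) (q j * R j)),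
      ‖∑ u ∈ Finset.range P, vme (vmP (fun j => A j * m j) (vmS D u))‖ ^ (2 * k)
     ≤ vmJ D k (Finset.range P) * ∏ j, ((2 * q j : ℝ) * (2 * q j * R j)) := by
  classical
  set B := Fintype.piFinset (fun j => Finset.Ico (-(q j * R j : ℤ)) (q j * R j)) with hB
  set Y := Fintype.piFinset (fun _ : Fin k => Finset.range P) with hY
  let G : (Fin D → ℤ) → ℝ := fun t => ∏ j, if (R j : ℤ) ∣ t j then (2 * q j * R j : ℝ) else 0
  have hG0 : ∀ t, 0 ≤ G t := fun t => Finset.prod_nonneg fun j _ => by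
    split_ifs <;> positivity
  have hinner : ∀ t : Fin D → ℤ, ‖∑ m ∈ B, vme (vmP (fun j => A j * m j) t)‖ ≤ G t := by
    intro t
    have : ∑ m ∈ B, vme (vmP (fun j => A j * m j) t)
       = ∏ j, ∑ m ∈ Finset.Ico (-(q j * R j : ℤ)) (q j * R j), vme (A j * m * t j) := by
      rw [Finset.prod_univ_sum]
      apply Finset.sum_congr rfl
      intro m _
      rw [vmP, vme_sum]
    rw [this, norm_prod]
    apply Finset.prod_le_prod
    · intro j _
      positivity
    · intro j _
      exact vm_geom (A j) (R j) (q j) (hR j) (t j) (hA j)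
  have h1 : ∑ m ∈ B, ‖∑ u ∈ Finset.range P, vme (vmP (fun j => A j * m j) (vmS D u))‖ ^ (2 * k)
      ≤ ∑ p ∈ Y ×ˢ Y, G (vmPS D p.1 - vmPS D p.2) := by
    have hc : ((∑ m ∈ B, ‖∑ u ∈ Finset.range P, vme (vmP (fun j => A j * m j) (vmS D u))‖ ^ (2 * k) : ℝ) : ℂ)
       = ∑ p ∈ Y ×ˢ Y, ∑ m ∈ B, vme (vmP (fun j => A j * m j) (vmPS D p.1 - vmPS D p.2)) := by
      rw [Complex.ofReal_sum]
      simp_rw [vm_expand]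
      rw [Finset.sum_comm]
    calc _ ≤ ‖((∑ m ∈ B, ‖∑ u ∈ Finset.range P, vme (vmP (fun j => A j * m j) (vmS D u))‖ ^ (2 * k) : ℝ) : ℂ)‖ := by
          rw [Complex.norm_real]
          exact le_abs_self _
      _ ≤ _ := by
          rw [hc]
          refine (norm_sum_le _ _).trans ?_
          apply Finset.sum_le_sum
          intro p _
          exact hinner _
  refine h1.trans ((vm_fiber Y (vmPS D) B ?_ G hG0).trans ?_)
  · intro y hy y' hy'
    rw [hB, Fintype.mem_piFinset]
    intro j
    rw [hY, Fintype.mem_piFinset] at hy hy'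
    have hb := vm_ps_bound (D := D) y y' (fun i => Finset.mem_range.1 (hy i)) (fun i => Finset.mem_range.1 (hy' i)) j
    have hq' : (k * P ^ (j.1 + 1) : ℤ) < q j * R j := by exact_mod_cast hq j
    rw [abs_le] at hb
    rw [Finset.mem_Ico]
    constructor <;> linarith [hb.1, hb.2]
  · have e : ∑ t ∈ B, G t ≤ ∏ j, ((2 * q j : ℝ) * (2 * q j * R j)) := by
      have : ∑ t ∈ B, G t = ∏ j, ∑ t ∈ Finset.Ico (-(q j * R j : ℤ)) (q j * R j),
          (if (R j : ℤ) ∣ t then (2 * q j * R j : ℝ) else 0) := by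
        rw [Finset.prod_univ_sum]
      rw [this]
      apply Finset.prod_le_prod
      · intro j _
        apply Finset.sum_nonneg
        intro t _
        split_ifs <;> positivity
      · intro j _
        rw [← Finset.sum_filter, Finset.sum_const, nsmul_eq_mul]
        apply mul_le_mul_of_nonneg_right _ (by positivity)
        have hc : ((Finset.Ico (-(q j * R j : ℤ)) (q j * R j)).filter (fun t => (R j : ℤ) ∣ t)).card ≤ 2 * q j := by
          have hs : (Finset.Ico (-(q j * R j : ℤ)) (q j * R j)).filter (fun t => (R j : ℤ) ∣ t)
              ⊆ (Finset.Ico (-(q j : ℤ)) (q j)).image (fun x => (R j : ℤ) * x) := by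
            intro t ht
            rw [Finset.mem_filter, Finset.mem_Ico] at ht
            obtain ⟨⟨t1, t2⟩, x, rfl⟩ := ht
            have hRj : (0 : ℤ) < R j := by exact_mod_cast hR j
            refine Finset.mem_image.2 ⟨x, Finset.mem_Ico.2 ⟨?_, ?_⟩, rfl⟩
            · by_contra hx
              nlinarith
            · by_contra hx
              nlinarith
          refine (Finset.card_le_card hs).trans (Finset.card_image_le.trans ?_)
          rw [Int.card_Ico]
          omega
        exact_mod_cast hc
    exact mul_le_mul_of_nonneg_left e (by positivity)

theorem vm_bilinear {D k P : ℕ} (hk : 1 ≤ k) (A : Fin D → ℝ) (R : Fin D → ℕ) (hR : ∀ j, 1 ≤ R j)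
    (hRP : ∀ j : Fin D, R j ≤ P ^ (j.1 + 1))
    (hA : ∀ j, R j = 1 ∨ ((∃ z : ℤ, A j * R j = z) ∧ ∀ d : ℤ, (∃ z : ℤ, A j * d = z) → (R j : ℤ) ∣ d)) :
    ‖∑ u ∈ Finset.range P, ∑ v ∈ Finset.range P, vme (∑ j : Fin D, A j * ((u : ℝ) * v) ^ (j.1 + 1))‖ ^ (2 * k * (2 * k))
      ≤ (P : ℝ) ^ (4 * k * (2 * k - 1)) * (vmJ D k (Finset.range P)) ^ 2 *
        ∏ j : Fin D, ((4 * k * P ^ (j.1 + 1)) ^ 2 / R j : ℝ) := by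
  classical
  set Y := Fintype.piFinset (fun _ : Fin k => Finset.range P) with hY
  set J := vmJ D k (Finset.range P) with hJ
  let F : (Fin D → ℤ) → ℂ := fun m => ∑ u ∈ Finset.range P, vme (vmP (fun j => A j * m j) (vmS D u))
  let q : Fin D → ℕ := fun j => k * P ^ (j.1 + 1) / R j + 1
  have hq : ∀ j, k * P ^ (j.1 + 1) < q j * R j := by
    intro j
    have := Nat.lt_div_mul_add (a := k * P ^ (j.1 + 1)) (hR j)
    simp only [q]
    rw [add_mul, one_mul]
    exact this
  have hq2 : ∀ j, 2 * q j * R j ≤ 4 * k * P ^ (j.1 + 1) := by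
    intro j
    have h1 := Nat.div_mul_le_self (k * P ^ (j.1 + 1)) (R j)
    have h2 := hRP j
    have h3 : P ^ (j.1 + 1) ≤ k * P ^ (j.1 + 1) := Nat.le_mul_of_pos_left _ hk
    simp only [q]
    nlinarith
  set W := ∑ u ∈ Finset.range P, ∑ v ∈ Finset.range P, vme (∑ j : Fin D, A j * ((u : ℝ) * v) ^ (j.1 + 1)) with hW
  have s1 : ‖W‖ ^ (2 * k) ≤ (P : ℝ) ^ (2 * k - 1) * ∑ p ∈ Y ×ˢ Y, ‖F (vmPS D p.1 - vmPS D p.2)‖ := by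
    have h := vm_card_pow_sum (Finset.range P) (fun u => ∑ v ∈ Finset.range P, vme (∑ j : Fin D, A j * ((u : ℝ) * v) ^ (j.1 + 1)))
      (2 * k) (by omega)
    rw [Finset.card_range] at h
    refine h.trans ?_
    apply mul_le_mul_of_nonneg_left _ (by positivity)
    have hc : ((∑ u ∈ Finset.range P, ‖∑ v ∈ Finset.range P, vme (∑ j : Fin D, A j * ((u : ℝ) * v) ^ (j.1 + 1))‖ ^ (2 * k) : ℝ) : ℂ)
      = ∑ p ∈ Y ×ˢ Y, F (vmPS D p.1 - vmPS D p.2) := by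
      rw [Complex.ofReal_sum]
      have e : ∀ u v : ℕ, (∑ j : Fin D, A j * ((u : ℝ) * v) ^ (j.1 + 1))
          = vmP (fun j => A j * (u : ℝ) ^ (j.1 + 1)) (vmS D v) := by
        intro u v
        rw [vmP]
        apply Finset.sum_congr rfl
        intro j _
        simp [vmS, mul_pow, mul_assoc]
      simp_rw [e, vm_expand, F]
      rw [Finset.sum_comm]
      refine Finset.sum_congr rfl fun p _ => Finset.sum_congr rfl fun u _ => ?_
      congr 1
      rw [vmP, vmP]
      apply Finset.sum_congr rfl
      intro j _
      simp only [vmS]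
      push_cast
      ring
    calc _ ≤ ‖((∑ u ∈ Finset.range P, ‖∑ v ∈ Finset.range P, vme (∑ j : Fin D, A j * ((u : ℝ) * v) ^ (j.1 + 1))‖ ^ (2 * k) : ℝ) : ℂ)‖ := by
          rw [Complex.norm_real]
          exact le_abs_self _
      _ ≤ _ := by
          rw [hc]
          exact norm_sum_le _ _
  have hYc : ((Y ×ˢ Y).card : ℝ) = (P : ℝ) ^ (2 * k) := by
    rw [Finset.card_product, hY, Fintype.card_piFinset]
    simp
    ring
  have s2 : (∑ p ∈ Y ×ˢ Y, ‖F (vmPS D p.1 - vmPS D p.2)‖) ^ (2 * k)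
     ≤ ((P : ℝ) ^ (2 * k)) ^ (2 * k - 1) * ∑ p ∈ Y ×ˢ Y, ‖F (vmPS D p.1 - vmPS D p.2)‖ ^ (2 * k) := by
    have := pow_sum_le_card_mul_sum_pow (s := Y ×ˢ Y) (f := fun p => ‖F (vmPS D p.1 - vmPS D p.2)‖)
      (fun c _ => norm_nonneg _) (2 * k - 1)
    rw [Nat.sub_add_cancel (by omega), hYc] at this
    exact this
  have s3 : ∑ p ∈ Y ×ˢ Y, ‖F (vmPS D p.1 - vmPS D p.2)‖ ^ (2 * k) ≤
     J * ∑ m ∈ Fintype.piFinset (fun j => Finset.Ico (-(q j * R j : ℤ)) (q j * R j)), ‖F m‖ ^ (2 * k) := by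
    refine vm_fiber Y (vmPS D) _ ?_ (fun t => ‖F t‖ ^ (2 * k)) (fun t => by positivity)
    intro y hy y' hy'
    rw [Fintype.mem_piFinset]
    intro j
    rw [hY, Fintype.mem_piFinset] at hy hy'
    have hb := vm_ps_bound (D := D) y y' (fun i => Finset.mem_range.1 (hy i)) (fun i => Finset.mem_range.1 (hy' i)) j
    have hq' : (k * P ^ (j.1 + 1) : ℤ) < q j * R j := by exact_mod_cast hq j
    rw [abs_le] at hb
    rw [Finset.mem_Ico]
    constructor <;> linarith [hb.1, hb.2]
  have s4 := vm_box_sum (k := k) (P := P) A R q hR hq hA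
  have s5 : ∏ j, ((2 * q j : ℝ) * (2 * q j * R j)) ≤ ∏ j : Fin D, ((4 * k * P ^ (j.1 + 1)) ^ 2 / R j : ℝ) := by
    apply Finset.prod_le_prod
    · intro j _
      positivity
    · intro j _
      have hRj : (0 : ℝ) < R j := by exact_mod_cast hR j
      rw [le_div_iff₀ hRj]
      have : (2 * q j * R j : ℝ) ≤ 4 * k * P ^ (j.1 + 1) := by exact_mod_cast hq2 j
      calc (2 * q j : ℝ) * (2 * q j * R j) * R j = (2 * q j * R j : ℝ) ^ 2 := by ring
        _ ≤ _ := by gcongr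
  calc ‖W‖ ^ (2 * k * (2 * k)) = (‖W‖ ^ (2 * k)) ^ (2 * k) := by rw [pow_mul]
    _ ≤ ((P : ℝ) ^ (2 * k - 1) * ∑ p ∈ Y ×ˢ Y, ‖F (vmPS D p.1 - vmPS D p.2)‖) ^ (2 * k) := by gcongr
    _ = ((P : ℝ) ^ (2 * k)) ^ (2 * k - 1) * (∑ p ∈ Y ×ˢ Y, ‖F (vmPS D p.1 - vmPS D p.2)‖) ^ (2 * k) := by
        rw [mul_pow]
        congr 1
        rw [← pow_mul, ← pow_mul, mul_comm]
    _ ≤ ((P : ℝ) ^ (2 * k)) ^ (2 * k - 1) * (((P : ℝ) ^ (2 * k)) ^ (2 * k - 1) * (J * (J *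
         ∏ j : Fin D, ((4 * k * P ^ (j.1 + 1)) ^ 2 / R j : ℝ)))) := by
        apply mul_le_mul_of_nonneg_left _ (by positivity)
        refine s2.trans ?_
        apply mul_le_mul_of_nonneg_left _ (by positivity)
        refine s3.trans ?_
        apply mul_le_mul_of_nonneg_left _ (by positivity)
        refine s4.trans ?_
        exact mul_le_mul_of_nonneg_left s5 (by positivity)
    _ = _ := by
        have : 4 * k * (2 * k - 1) = 2 * k * (2 * k - 1) + 2 * k * (2 * k - 1) := by ring
        rw [this, pow_add, ← pow_mul]
        ring


theorem vm_five_pow (k : ℕ) : ∃ w : ℤ, Odd w ∧ (5 : ℤ) ^ (2 ^ k) = 1 + 2 ^ (k + 2) * w := by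
  induction k with
  | zero => exact ⟨1, by decide, by norm_num⟩
  | succ k ih =>
    obtain ⟨w, hw, h⟩ := ih
    refine ⟨w + 2 ^ (k + 1) * w ^ 2, ?_, ?_⟩
    · apply Odd.add_even hw
      exact (((even_two : Even (2 : ℤ)).pow_of_ne_zero (by omega))).mul_right _
    · rw [pow_succ 2 k, pow_mul, h]
      ring

theorem vm_lift (a b : ℤ) (N M : ℕ) (hN : 1 ≤ N) (h : (2 : ℤ) ^ N ∣ a - b) :
    (2 : ℤ) ^ (N + M) ∣ a ^ (2 ^ M) - b ^ (2 ^ M) := by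
  induction M with
  | zero => simpa using h
  | succ M ih =>
    rw [pow_succ 2 M, pow_mul, pow_mul]
    have e : (a ^ 2 ^ M) ^ 2 - (b ^ 2 ^ M) ^ 2 = (a ^ 2 ^ M - b ^ 2 ^ M) * (a ^ 2 ^ M + b ^ 2 ^ M) := by ring
    rw [e, ← add_assoc, pow_succ (2 : ℤ) (N + M)]
    apply mul_dvd_mul ih
    have h2 : (2 : ℤ) ∣ a ^ 2 ^ M - b ^ 2 ^ M :=
      (dvd_pow_self 2 (by omega)).trans ih
    have : a ^ 2 ^ M + b ^ 2 ^ M = (a ^ 2 ^ M - b ^ 2 ^ M) + 2 * b ^ 2 ^ M := by ring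
    rw [this]
    exact dvd_add h2 (dvd_mul_right _ _)

theorem vm_gen (N : ℕ) (x : ℤ) (hx : (4 : ℤ) ∣ x - 1) : ∃ i : ℕ, (2 : ℤ) ^ (N + 2) ∣ x - 5 ^ i := by
  induction N with
  | zero => exact ⟨0, by simpa using hx⟩
  | succ N ih =>
    obtain ⟨i, y, hy⟩ := ih
    rcases Int.even_or_odd y with ⟨z, hz⟩ | ⟨z, hz⟩
    · refine ⟨i, z, ?_⟩
      rw [hy, hz]
      ring
    · obtain ⟨w, ⟨v, hv⟩, hw⟩ := vm_five_pow N
      obtain ⟨s, hs⟩ : Odd ((5 : ℤ) ^ i) := Odd.pow (by decide)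
      refine ⟨i + 2 ^ N, z - (v + s + 2 * s * v), ?_⟩
      rw [pow_add, hw]
      have : x = 5 ^ i + 2 ^ (N + 2) * y := by rw [← hy]; ring
      rw [this, hz, hs, hv]
      ring

theorem vm_char_log (g : ℤ → ℂ) (N : ℕ) (hN : 3 ≤ N) (h1 : g 1 = 1) (hmul : ∀ x y, g (x * y) = g x * g y)
    (hper : ∀ x y : ℤ, (2 : ℤ) ^ N ∣ x - y → g x = g y) (hy : ∃ y : ℤ, g (1 + 2 ^ (N - 1) * y) ≠ 1) :
    ∃ c : ℤ, Odd c ∧ ∀ x : ℤ, (4 : ℤ) ∣ x →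
      g (1 + x) = vme ((c * ((1 + x) ^ (2 ^ N) - 1) : ℤ) / (2 : ℝ) ^ (2 * N)) := by
  have gpow : ∀ (x : ℤ) (i : ℕ), g (x ^ i) = g x ^ i := by
    intro x i
    induction i with
    | zero => simpa using h1
    | succ i ih => rw [pow_succ, hmul, ih, pow_succ]
  obtain ⟨M, rfl⟩ : ∃ M, N = M + 2 := ⟨N - 2, by omega⟩
  have hroot : g 5 ^ (2 ^ M) = 1 := by
    rw [← gpow]
    obtain ⟨w, _, hw⟩ := vm_five_pow M
    rw [← h1]
    apply hper
    rw [hw]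
    exact ⟨w, by ring⟩
  obtain ⟨b, hb, hb2⟩ := (Complex.isPrimitiveRoot_exp (2 ^ M) (by positivity)).eq_pow_of_pow_eq_one hroot
  have hg5 : g 5 = vme (b / (2 : ℝ) ^ M) := by
    rw [← hb2, vme, ← Complex.exp_nat_mul]
    congr 1
    push_cast
    ring
  have g5pow : ∀ i : ℕ, g (5 ^ i) = vme (i * (b / (2 : ℝ) ^ M)) := by
    intro i
    rw [gpow, hg5, vme, vme, ← Complex.exp_nat_mul]
    congr 1
    push_cast
    ring
  obtain ⟨w, hwo, hw⟩ := vm_five_pow (M + 2)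
  -- b is odd
  have hbo : Odd (b : ℤ) := by
    by_contra hbe
    rw [Int.not_odd_iff_even] at hbe
    obtain ⟨r, hr⟩ := hbe
    obtain ⟨y, hy⟩ := hy
    obtain ⟨K, rfl⟩ : ∃ K, M = K + 1 := ⟨M - 1, by omega⟩
    apply hy
    rcases Int.even_or_odd y with ⟨z, hz⟩ | ⟨z, hz⟩
    · rw [← h1]
      apply hper
      refine ⟨z, ?_⟩
      rw [hz, show K + 1 + 2 - 1 = K + 2 by omega]
      ring
    · obtain ⟨w', ⟨v, hv⟩, hw'⟩ := vm_five_pow K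
      have e : g (1 + 2 ^ (K + 1 + 2 - 1) * y) = g (5 ^ (2 ^ K)) := by
        apply hper
        refine ⟨z - v, ?_⟩
        rw [hw', hz, hv, show K + 1 + 2 - 1 = K + 2 by omega]
        ring
      rw [e, g5pow, vme_eq_one_iff]
      refine ⟨r, ?_⟩
      have : (b : ℝ) = r + r := by exact_mod_cast hr
      rw [this]
      push_cast
      field_simp
      ring
  -- c
  have hcop : IsCoprime w ((2 : ℤ) ^ (M + 1)) :=
    (IsCoprime.pow_right (Int.isCoprime_iff_gcd_eq_one.2 (by
      rw [← Int.isCoprime_iff_gcd_eq_one]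
      obtain ⟨v, hv⟩ := hwo
      exact ⟨1, -v, by rw [hv]; ring⟩)))
  obtain ⟨a1, a2, ha⟩ := hcop
  have hca : Odd a1 := by
    have : Odd (a1 * w) := by
      have e : a1 * w = 1 - a2 * 2 ^ (M + 1) := by linarith
      rw [e]
      apply Odd.sub_even odd_one
      exact ((even_two : Even (2 : ℤ)).pow_of_ne_zero (by omega)).mul_left _
    exact (Int.odd_mul.1 this).1
  refine ⟨a1 * b, hca.mul hbo, ?_⟩
  intro x hx
  obtain ⟨i, hi⟩ := vm_gen M (1 + x) (by simpa using hx)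
  have hgx : g (1 + x) = g (5 ^ i) := hper _ _ hi
  rw [hgx, g5pow]
  -- compute (1+x)^(2^N)
  obtain ⟨d1, hd1⟩ := vm_lift (1 + x) (5 ^ i) (M + 2) (M + 2) (by omega) hi
  have h5 : ∃ d2 : ℤ, ((5 : ℤ) ^ i) ^ 2 ^ (M + 2) = 1 + i * (2 ^ (M + 4) * w) + 2 ^ (2 * (M + 4)) * d2 := by
    rw [← pow_mul, mul_comm i, pow_mul, hw]
    clear hd1 hgx hi
    induction i with
    | zero => exact ⟨0, by simp⟩
    | succ i ih =>
      obtain ⟨d2, h⟩ := ih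
      refine ⟨d2 + i * w ^ 2 + d2 * 2 ^ (M + 4) * w, ?_⟩
      rw [pow_succ, h]
      push_cast
      ring
  obtain ⟨d2, hd2⟩ := h5
  have hE : (1 + x) ^ (2 ^ (M + 2)) - 1 = i * (2 ^ (M + 4) * w) + 2 ^ (2 * (M + 2)) * (d1 + 2 ^ 4 * d2) := by
    have : (1 + x) ^ (2 ^ (M + 2)) = ((5 : ℤ) ^ i) ^ 2 ^ (M + 2) + 2 ^ (M + 2 + (M + 2)) * d1 := by
      rw [← hd1]; ring
    rw [this, hd2]
    ring
  rw [hE]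
  have hfin : ((a1 * b * (i * (2 ^ (M + 4) * w) + 2 ^ (2 * (M + 2)) * (d1 + 2 ^ 4 * d2)) : ℤ) : ℝ) / (2 : ℝ) ^ (2 * (M + 2))
      = i * (b / (2 : ℝ) ^ M) + ((a1 * b * (d1 + 2 ^ 4 * d2) - 2 * i * b * a2 : ℤ) : ℝ) := by
    have haR : (a1 : ℝ) * w = 1 - a2 * 2 ^ (M + 1) := by
      have : (a1 : ℝ) * w + a2 * 2 ^ (M + 1) = 1 := by exact_mod_cast ha
      linarith
    push_cast
    have e2 : (2 : ℝ) ^ (2 * (M + 2)) = 2 ^ (M + 4) * 2 ^ M := by ring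
    rw [e2]
    have hp : (2 : ℝ) ^ M ≠ 0 := by positivity
    have hp' : (2 : ℝ) ^ (M + 4) ≠ 0 := by positivity
    rw [div_eq_iff (by positivity)]
    have : (a1 : ℝ) * b * (i * (2 ^ (M + 4) * w) + 2 ^ (M + 4) * 2 ^ M * (d1 + 16 * d2))
       = 2 ^ (M + 4) * b * i * (a1 * w) + a1 * b * (2 ^ (M + 4) * 2 ^ M * (d1 + 16 * d2)) := by ring
    rw [this, haR]
    have h3 : (i : ℝ) * (b / (2 : ℝ) ^ M) * (2 ^ (M + 4) * 2 ^ M) = i * b * 2 ^ (M + 4) := by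
      field_simp
    rw [add_mul, h3]
    ring
  rw [hfin, vme_add, vme_int, mul_one]


theorem vm_choose_val (N j : ℕ) (hj : 1 ≤ j) (hjN : j ≤ 2 ^ N) :
    ∃ o : ℕ, Odd o ∧ (2 ^ N).choose j * 2 ^ (j.factorization 2) = 2 ^ N * o := by
  have h := Nat.factorization_choose_prime_pow_add_factorization Nat.prime_two hjN (by omega)
  have hc : (2 ^ N).choose j ≠ 0 := (Nat.choose_pos hjN).ne'
  refine ⟨(2 ^ N).choose j / 2 ^ (((2 ^ N).choose j).factorization 2), ?_, ?_⟩
  · rw [← Nat.not_even_iff_odd, even_iff_two_dvd]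
    exact Nat.not_dvd_ordCompl Nat.prime_two hc
  · have h2 := Nat.ordProj_mul_ordCompl_eq_self ((2 ^ N).choose j) 2
    set o := (2 ^ N).choose j / 2 ^ (((2 ^ N).choose j).factorization 2)
    have h3 : 2 ^ N = 2 ^ (((2 ^ N).choose j).factorization 2) * 2 ^ (j.factorization 2) := by
      rw [← pow_add, h]
    calc (2 ^ N).choose j * 2 ^ (j.factorization 2)
        = (2 ^ (((2 ^ N).choose j).factorization 2) * o) * 2 ^ (j.factorization 2) := by rw [h2]
      _ = (2 ^ (((2 ^ N).choose j).factorization 2) * 2 ^ (j.factorization 2)) * o := by ring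
      _ = _ := by rw [← h3]

/-- The coefficients. -/
noncomputable def vmA (N t : ℕ) (c w : ℤ) (j : ℕ) : ℝ :=
  (c * (2 ^ N).choose j * (2 ^ t * w) ^ j : ℤ) / (2 : ℝ) ^ (2 * N)

theorem vmA_eq (N t : ℕ) (c w : ℤ) (hc : Odd c) (hw : Odd w) (j : ℕ) (hj : 1 ≤ j) (hjN : j ≤ 2 ^ N) :
    ∃ o : ℤ, Odd o ∧ vmA N t c w j * 2 ^ (N + j.factorization 2) = o * 2 ^ (t * j) := by
  obtain ⟨o, ho, h⟩ := vm_choose_val N j hj hjN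
  refine ⟨c * o * w ^ j, (hc.mul (by exact_mod_cast ho)).mul hw.pow, ?_⟩
  have hR : ((2 ^ N).choose j : ℝ) * 2 ^ (j.factorization 2) = 2 ^ N * o := by exact_mod_cast h
  rw [vmA]
  have e : (2 : ℝ) ^ (2 * N) = 2 ^ N * 2 ^ N := by ring
  rw [e, div_mul_eq_mul_div, div_eq_iff (by positivity)]
  push_cast
  calc (c : ℝ) * ((2 ^ N).choose j) * (2 ^ t * w) ^ j * 2 ^ (N + j.factorization 2)
      = c * (2 ^ t * w) ^ j * 2 ^ N * (((2 ^ N).choose j : ℝ) * 2 ^ (j.factorization 2)) := by rw [pow_add]; ring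
    _ = _ := by
      rw [hR, mul_pow, pow_mul]
      ring

theorem vmA_int (N t : ℕ) (c w : ℤ) (hc : Odd c) (hw : Odd w) (j : ℕ) (hj : 1 ≤ j) (hjN : j ≤ 2 ^ N)
    (h : N + j.factorization 2 ≤ t * j) : ∃ z : ℤ, vmA N t c w j = z := by
  obtain ⟨o, _, ho⟩ := vmA_eq N t c w hc hw j hj hjN
  refine ⟨o * 2 ^ (t * j - (N + j.factorization 2)), ?_⟩
  have hp : (2 : ℝ) ^ (N + j.factorization 2) ≠ 0 := by positivity
  apply mul_right_cancel₀ hp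
  rw [ho]
  push_cast
  rw [mul_assoc, ← pow_add, Nat.sub_add_cancel h]

theorem vmA_frac (N t : ℕ) (c w : ℤ) (hc : Odd c) (hw : Odd w) (j r : ℕ) (hj : 1 ≤ j) (hjN : j ≤ 2 ^ N)
    (h : t * j + r = N + j.factorization 2) :
    (∃ z : ℤ, vmA N t c w j * (2 ^ r : ℕ) = z) ∧
      ∀ d : ℤ, (∃ z : ℤ, vmA N t c w j * d = z) → ((2 ^ r : ℕ) : ℤ) ∣ d := by
  obtain ⟨o, hodd, ho⟩ := vmA_eq N t c w hc hw j hj hjN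
  have hp : (2 : ℝ) ^ (t * j) ≠ 0 := by positivity
  have h1 : vmA N t c w j * 2 ^ r = o := by
    apply mul_right_cancel₀ hp
    rw [← ho, ← h, pow_add]
    ring
  refine ⟨⟨o, by push_cast; exact h1⟩, ?_⟩
  rintro d ⟨z, hz⟩
  have h2 : (o : ℝ) * d = 2 ^ r * z := by
    rw [← h1, ← hz]
    ring
  have h3 : o * d = 2 ^ r * z := by exact_mod_cast h2
  have hcop : IsCoprime ((2 : ℤ) ^ r) o := by
    apply IsCoprime.pow_left
    obtain ⟨v, hv⟩ := hodd
    exact ⟨-v, 1, by rw [hv]; ring⟩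
  push_cast
  exact hcop.dvd_of_dvd_mul_left ⟨z, h3⟩

theorem vm_char_poly (g : ℤ → ℂ) (N t D : ℕ) (c w : ℤ) (hc : Odd c) (hw : Odd w)
    (hg : ∀ x : ℤ, (4 : ℤ) ∣ x → g (1 + x) = vme ((c * ((1 + x) ^ (2 ^ N) - 1) : ℤ) / (2 : ℝ) ^ (2 * N)))
    (ht : 2 ≤ t) (hD : D ≤ 2 ^ N) (hDj : ∀ j, D < j → N + j.factorization 2 ≤ t * j) (y : ℤ) :
    g (1 + 2 ^ t * w * y) = vme (∑ j : Fin D, vmA N t c w (j.1 + 1) * (y : ℝ) ^ (j.1 + 1)) := by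
  rw [hg _ ((Dvd.intro_left (2 ^ (t - 2)) (by
    rw [show (4 : ℤ) = 2 ^ 2 by norm_num, ← pow_add, Nat.sub_add_cancel ht] : (2 : ℤ) ^ (t - 2) * 4 = 2 ^ t)).mul_right _ |>.mul_right _)]
  have e1 : (((c * ((1 + 2 ^ t * w * y) ^ (2 ^ N) - 1) : ℤ) : ℝ) / (2 : ℝ) ^ (2 * N))
      = ∑ j ∈ Finset.range (2 ^ N), vmA N t c w (j + 1) * (y : ℝ) ^ (j + 1) := by
    rw [add_comm 1 (2 ^ t * w * y), add_pow, Finset.sum_range_succ']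
    simp only [one_pow, mul_one, pow_zero, Nat.choose_zero_right, Nat.cast_one, add_sub_cancel_right]
    rw [Finset.mul_sum]
    push_cast
    rw [Finset.sum_div]
    apply Finset.sum_congr rfl
    intro j _
    rw [vmA]
    push_cast
    rw [mul_pow]
    ring
  rw [e1, ← Finset.sum_range_add_sum_Ico _ hD, vme_add, Fin.sum_univ_eq_sum_range
    (fun j => vmA N t c w (j + 1) * (y : ℝ) ^ (j + 1)) D]
  have e2 : vme (∑ j ∈ Finset.Ico D (2 ^ N), vmA N t c w (j + 1) * (y : ℝ) ^ (j + 1)) = 1 := by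
    rw [vme_sum]
    apply Finset.prod_eq_one
    intro j hj
    rw [Finset.mem_Ico] at hj
    obtain ⟨z, hz⟩ := vmA_int N t c w hc hw (j + 1) (by omega) (by omega) (hDj _ (by omega))
    rw [hz, vme_eq_one_iff]
    exact ⟨z * y ^ (j + 1), by push_cast; ring⟩
  rw [e2, mul_one]


theorem vm_numeric (N h lam D b0 k i d : ℝ) (hh : 1 ≤ h) (hN : h ≤ N) (hlam : 1 ≤ lam)
    (hK : 10 ^ 10 * lam * N ^ 2 ≤ h ^ 3) (hD1 : 13 ≤ D) (hD2 : D * h ≤ 13 * N) (hb : 2800 * b0 ≤ h) (hb0 : 0 ≤ b0)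
    (hk0 : 0 ≤ k) (hk : k ≤ 11 * D ^ 2) (hi : N ≤ 2 * (i * h)) (hd : 2 * d = D * (D + 1)) :
    2 * (370 * lam * D ^ 3 + b0 * d) + 6 * lam * D + 16 * lam * k ^ 2 ≤ 0.4 * N * i := by
  have hD0 : 0 < D := by linarith
  have hh0 : 0 < h := by linarith
  have hN0 : 0 < N := by linarith
  have e1 : k ^ 2 ≤ 121 * D ^ 4 := by
    calc k ^ 2 ≤ (11 * D ^ 2) ^ 2 := by gcongr
      _ = _ := by ring
  have e2 : D ^ 3 ≤ D ^ 4 := pow_le_pow_right₀ (by linarith) (by norm_num)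
  have e3 : D ≤ D ^ 4 := le_self_pow₀ (by linarith) (by norm_num)
  have e4 : 740 * lam * D ^ 3 + 6 * lam * D + 16 * lam * k ^ 2 ≤ 2700 * lam * D ^ 4 := by
    have a1 : lam * k ^ 2 ≤ lam * (121 * D ^ 4) := by gcongr
    have a2 : lam * D ^ 3 ≤ lam * D ^ 4 := by gcongr
    have a3 : lam * D ≤ lam * D ^ 4 := by gcongr
    have a4 : 0 ≤ lam * D ^ 4 := by positivity
    nlinarith
  have e5 : lam * D ^ 4 * h ≤ (1 / 10 ^ 5) * N ^ 2 := by
    have b1 : (D * h) ^ 4 ≤ (13 * N) ^ 4 := by gcongr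
    have b2 : (lam * D ^ 4 * h) * h ^ 3 ≤ ((1 / 10 ^ 5) * N ^ 2) * h ^ 3 := by
      calc (lam * D ^ 4 * h) * h ^ 3 = lam * (D * h) ^ 4 := by ring
        _ ≤ lam * (13 * N) ^ 4 := by gcongr
        _ = (28561 / 10 ^ 10) * N ^ 2 * (10 ^ 10 * lam * N ^ 2) := by ring
        _ ≤ (28561 / 10 ^ 10) * N ^ 2 * h ^ 3 := by gcongr
        _ ≤ _ := by
          have : 0 ≤ N ^ 2 * h ^ 3 := by positivity
          nlinarith
    exact le_of_mul_le_mul_right b2 (by positivity)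
  have e6 : 2 * (b0 * d) * h ≤ 0.0651 * N ^ 2 := by
    have c1 : D * (D + 1) ≤ (14 / 13) * D ^ 2 := by nlinarith
    calc 2 * (b0 * d) * h = b0 * (D * (D + 1)) * h := by rw [← hd]; ring
      _ ≤ (h / 2800) * ((14 / 13) * D ^ 2) * h := by
          gcongr
          linarith
      _ = (14 / 13 / 2800) * (D * h) ^ 2 := by ring
      _ ≤ (14 / 13 / 2800) * (13 * N) ^ 2 := by gcongr
      _ ≤ _ := by
          have : 0 ≤ N ^ 2 := by positivity
          nlinarith
  have e7 : 0.2 * N ^ 2 ≤ 0.4 * N * i * h := by nlinarith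
  have fin : (2 * (370 * lam * D ^ 3 + b0 * d) + 6 * lam * D + 16 * lam * k ^ 2) * h ≤ (0.4 * N * i) * h := by
    have g1 : (740 * lam * D ^ 3 + 6 * lam * D + 16 * lam * k ^ 2) * h ≤ 2700 * lam * D ^ 4 * h := by gcongr
    have : 0 ≤ N ^ 2 := by positivity
    nlinarith
  exact le_of_mul_le_mul_right fin hh0

set_option maxHeartbeats 4000000 in
theorem vm_inner (g : ℤ → ℂ) (N h lam : ℕ) (c : ℤ) (hc : Odd c) (hhN : h < N) (hh : 1 ≤ h) (hlam : 1 ≤ lam)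
    (hNl : N ≤ 2 ^ lam) (hK : 10 ^ 10 * lam * N ^ 2 ≤ h ^ 3)
    (hg : ∀ x : ℤ, (4 : ℤ) ∣ x → g (1 + x) = vme ((c * ((1 + x) ^ (2 ^ N) - 1) : ℤ) / (2 : ℝ) ^ (2 * N))) :
    ∃ P : ℕ, 0 < P ∧ Real.logb 2 P ≤ 0.4 * (h : ℝ) ∧ ∀ w : ℤ, Odd w →
      ‖∑ u ∈ Finset.range P, ∑ v ∈ Finset.range P, g (1 + 2 ^ (h / 10) * w * ((u : ℤ) * v))‖
        ≤ (P : ℝ) ^ 2 / 2 ^ (4 * lam) := by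
  have hKR : (10 : ℝ) ^ 10 * lam * N ^ 2 ≤ h ^ 3 := by exact_mod_cast hK
  have hhR : (1 : ℝ) ≤ h := by exact_mod_cast hh
  have hlR : (1 : ℝ) ≤ lam := by exact_mod_cast hlam
  have hNR : (h : ℝ) ≤ N := by exact_mod_cast hhN.le
  have hN0 : (0 : ℝ) < N := by linarith
  have hbig : (10 : ℝ) ^ 10 * lam * N ≤ h ^ 2 := by
    have : (10 : ℝ) ^ 10 * lam * N * N ≤ h ^ 2 * N := by
      calc (10 : ℝ) ^ 10 * lam * N * N = (10 : ℝ) ^ 10 * lam * N ^ 2 := by ring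
        _ ≤ (h : ℝ) ^ 2 * h := by rw [← pow_succ]; exact hKR
        _ ≤ _ := by gcongr
    exact le_of_mul_le_mul_right this hN0
  have hbig2 : (10 : ℝ) ^ 10 ≤ h := by
    have : (10 : ℝ) ^ 10 * N ≤ h * N := by
      calc (10 : ℝ) ^ 10 * N ≤ (10 : ℝ) ^ 10 * lam * N := by nlinarith
        _ ≤ (h : ℝ) * h := by rw [← sq]; exact hbig
        _ ≤ _ := by gcongr
    exact le_of_mul_le_mul_right this hN0
  set i := N / h with hi
  set D := 12 * N / h + 1 with hD
  have i1 : i * h ≤ N := Nat.div_mul_le_self N h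
  have i2 : N < (i + 1) * h := by
    have := Nat.lt_div_mul_add (a := N) hh
    rw [add_mul, one_mul]
    exact this
  have i3 : 1 ≤ i := by
    rw [hi, Nat.one_le_div_iff hh]
    exact hhN.le
  have d1 : D * h ≤ 12 * N + h := by
    have := Nat.div_mul_le_self (12 * N) h
    rw [hD, add_mul, one_mul]
    omega
  have d2 : 12 * N < D * h := by
    have := Nat.lt_div_mul_add (a := 12 * N) hh
    rw [hD, add_mul, one_mul]
    exact this
  have d3 : 12 * i < D := by
    by_contra hcon
    have : D * h ≤ 12 * i * h := Nat.mul_le_mul_right _ (not_lt.1 hcon)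
    nlinarith
  have i1R : (i : ℝ) * h ≤ N := by exact_mod_cast i1
  have i2R : (N : ℝ) < (i + 1) * h := by exact_mod_cast i2
  have i3R : (1 : ℝ) ≤ i := by exact_mod_cast i3
  have d1R : (D : ℝ) * h ≤ 13 * N := by
    have : (D : ℝ) * h ≤ 12 * N + h := by exact_mod_cast d1
    linarith
  have d2R : (12 : ℝ) * N < D * h := by exact_mod_cast d2
  have hD13 : 13 ≤ D := by omega
  have hD13R : (13 : ℝ) ≤ D := by exact_mod_cast hD13
  have hlD : 11 * D ^ 2 ≤ 2 ^ lam := by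
    have : (11 : ℝ) * D ^ 2 ≤ N := by
      have s1 : (11 * (D : ℝ) ^ 2) * h ^ 2 ≤ N * h ^ 2 := by
        calc (11 * (D : ℝ) ^ 2) * h ^ 2 = 11 * ((D : ℝ) * h) ^ 2 := by ring
          _ ≤ 11 * (13 * (N : ℝ)) ^ 2 := by gcongr
          _ ≤ (N : ℝ) * ((10 : ℝ) ^ 10 * lam * N) := by nlinarith [sq_nonneg (N : ℝ)]
          _ ≤ _ := by gcongr
      exact le_of_mul_le_mul_right s1 (by positivity)
    have : 11 * D ^ 2 ≤ N := by exact_mod_cast this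
    omega
  have hmv : 10 ^ 8 * lam * D ≤ h := by
    have : (10 : ℝ) ^ 8 * lam * D ≤ h := by
      have s1 : ((10 : ℝ) ^ 8 * lam * D) * h ≤ h * h := by
        calc ((10 : ℝ) ^ 8 * lam * D) * h = (10 : ℝ) ^ 8 * lam * (D * h) := by ring
          _ ≤ (10 : ℝ) ^ 8 * lam * (13 * N) := by gcongr
          _ ≤ (10 : ℝ) ^ 10 * lam * N := by nlinarith [mul_pos (by linarith : (0 : ℝ) < lam) hN0]
          _ ≤ _ := by rw [← sq]; exact hbig
      exact le_of_mul_le_mul_right s1 (by linarith)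
    exact_mod_cast this
  obtain ⟨P, k, b0, hP0, hk0, hk, hb0, hP1, hP2, hJ⟩ := vm_mvt D h lam (by omega) hlam hlD hmv
  refine ⟨P, hP0, hP2, ?_⟩
  intro w hw
  set t := h / 10 with ht
  have t1 : (t : ℝ) * 10 ≤ h := by exact_mod_cast Nat.div_mul_le_self h 10
  have t2 : (h : ℝ) ≤ t * 10 + 10 := by
    have : h ≤ t * 10 + 10 := by omega
    exact_mod_cast this
  have ht2 : 2 ≤ t := by
    have : (2 : ℝ) ≤ t := by linarith
    exact_mod_cast this
  have hfac : ∀ j : ℕ, j.factorization 2 ≤ j := by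
    intro j
    rcases Nat.eq_zero_or_pos j with rfl | hj
    · simp
    exact (Nat.factorization_lt 2 (by omega)).le
  have hDN : D ≤ 2 ^ N := by
    have h1 : 2 ^ lam ≤ 2 ^ N := by
      apply Nat.pow_le_pow_right (by norm_num)
      have : (lam : ℝ) ≤ N := by nlinarith
      exact_mod_cast this
    nlinarith
  have hDj : ∀ j, D < j → N + j.factorization 2 ≤ t * j := by
    intro j hj
    have q1 : (j.factorization 2 : ℝ) ≤ j := by exact_mod_cast hfac j
    have q2 : (D : ℝ) ≤ j := by exact_mod_cast hj.le
    have : (N : ℝ) + j.factorization 2 ≤ t * j := by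
      have q3 : (12 : ℝ) * N ≤ j * h := d2R.le.trans (by gcongr)
      nlinarith
    exact_mod_cast this
  let good : ℕ → Prop := fun j => 3 * i + 3 ≤ j ∧ j ≤ 6 * i
  have hgood1 : ∀ j, good j → (0.4 : ℝ) * N + t * j ≤ N := by
    rintro j ⟨_, g2⟩
    have g2R : (j : ℝ) ≤ 6 * i := by exact_mod_cast g2
    have : (t : ℝ) * j ≤ t * (6 * i) := by gcongr
    have : (t : ℝ) * 10 * i ≤ h * i := by gcongr
    nlinarith
  have hgood1' : ∀ j, good j → t * j ≤ N := by
    intro j hj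
    have := hgood1 j hj
    have : (t : ℝ) * j ≤ N := by nlinarith
    exact_mod_cast this
  classical
  let ρ : ℕ → ℕ := fun j => if good j then N + j.factorization 2 - t * j else 0
  let R : Fin D → ℕ := fun j => 2 ^ ρ (j.1 + 1)
  let A : Fin D → ℝ := fun j => vmA N t c w (j.1 + 1)
  have hR1 : ∀ j, 1 ≤ R j := fun j => Nat.one_le_two_pow
  have hRP : ∀ j : Fin D, R j ≤ P ^ (j.1 + 1) := by
    intro j
    simp only [R, ρ]
    split_ifs with hgd
    · have hgd1 := hgood1' _ hgd
      have g1R : (3 : ℝ) * i + 3 ≤ (j.1 + 1 : ℕ) := by exact_mod_cast hgd.1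
      have g2R : ((j.1 + 1 : ℕ) : ℝ) ≤ 6 * i := by exact_mod_cast hgd.2
      have q1 : (((j.1 + 1).factorization 2 : ℕ) : ℝ) ≤ (j.1 + 1 : ℕ) := by exact_mod_cast hfac (j.1 + 1)
      set J1 := j.1 + 1
      have hexp : ((N + J1.factorization 2 - t * J1 : ℕ) : ℝ) ≤ Real.logb 2 ((P : ℝ) ^ J1) := by
        rw [Nat.cast_sub (by omega), Real.logb_pow]
        push_cast
        have : (J1 : ℝ) * (0.35 * h) ≤ J1 * Real.logb 2 P := by gcongr
        have h3 : (3 * (i : ℝ) + 3) * (0.45 * h - 2) ≤ J1 * (0.45 * h - 2) := by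
          apply mul_le_mul_of_nonneg_right g1R
          linarith
        nlinarith
      have hPJ : (0 : ℝ) < (P : ℝ) ^ J1 := by positivity
      rw [Real.le_logb_iff_rpow_le (by norm_num) hPJ, Real.rpow_natCast] at hexp
      exact_mod_cast hexp
    · simp
      exact Nat.one_le_pow _ _ hP0
  have hA : ∀ j, R j = 1 ∨ ((∃ z : ℤ, A j * R j = z) ∧ ∀ d : ℤ, (∃ z : ℤ, A j * d = z) → (R j : ℤ) ∣ d) := by
    intro j
    by_cases hgd : good (j.1 + 1)
    · right
      have hgd1 := hgood1' _ hgd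
      have := j.2
      have := vmA_frac N t c w hc hw (j.1 + 1) (ρ (j.1 + 1)) (by omega) (by omega) (by
        simp only [ρ, if_pos hgd]
        omega)
      exact this
    · left
      simp [R, ρ, hgd]
  have hbil := vm_bilinear hk0 A R hR1 hRP hA
  have hW : (∑ u ∈ Finset.range P, ∑ v ∈ Finset.range P, g (1 + 2 ^ t * w * ((u : ℤ) * v)))
      = ∑ u ∈ Finset.range P, ∑ v ∈ Finset.range P, vme (∑ j : Fin D, A j * ((u : ℝ) * v) ^ (j.1 + 1)) := by
    refine Finset.sum_congr rfl fun u _ => Finset.sum_congr rfl fun v _ => ?_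
    rw [vm_char_poly g N t D c w hc hw hg ht2 hDN hDj]
    push_cast
    rfl
  rw [hW]
  set W := ∑ u ∈ Finset.range P, ∑ v ∈ Finset.range P, vme (∑ j : Fin D, A j * ((u : ℝ) * v) ^ (j.1 + 1))
  set d := D * (D + 1) / 2 with hd
  have hdd : 2 * d = D * (D + 1) := Nat.mul_div_cancel' (Nat.even_mul_succ_self D).two_dvd
  -- products
  have hprodR : ∏ j : Fin D, (R j : ℝ) = 2 ^ (∑ j ∈ Finset.range D, ρ (j + 1)) := by
    have : ∏ j : Fin D, (R j : ℝ) = ∏ j ∈ Finset.range D, (2 : ℝ) ^ ρ (j + 1) := by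
      rw [← Fin.prod_univ_eq_prod_range (fun j => (2 : ℝ) ^ ρ (j + 1)) D]
      apply Finset.prod_congr rfl
      intro j _
      simp [R]
    rw [this, Finset.prod_pow_eq_pow_sum]
  have hρsum : (0.4 : ℝ) * N * i ≤ ((∑ j ∈ Finset.range D, ρ (j + 1) : ℕ) : ℝ) := by
    have hsub : Finset.Ico (3 * i + 2) (6 * i) ⊆ Finset.range D := by
      intro j hj
      rw [Finset.mem_Ico] at hj
      rw [Finset.mem_range]
      omega
    have s1 : (∑ j ∈ Finset.Ico (3 * i + 2) (6 * i), (ρ (j + 1) : ℝ)) ≤ ((∑ j ∈ Finset.range D, ρ (j + 1) : ℕ) : ℝ) := by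
      push_cast
      exact Finset.sum_le_sum_of_subset_of_nonneg hsub (fun _ _ _ => by positivity)
    refine le_trans ?_ s1
    have s2 : ∀ j ∈ Finset.Ico (3 * i + 2) (6 * i), (0.4 : ℝ) * N ≤ ρ (j + 1) := by
      intro j hj
      rw [Finset.mem_Ico] at hj
      have hgd : good (j + 1) := ⟨by omega, by omega⟩
      have h1 := hgood1 _ hgd
      have h2 := hgood1' _ hgd
      simp only [ρ, if_pos hgd]
      rw [Nat.cast_sub (by omega)]
      have : (0 : ℝ) ≤ ((j + 1).factorization 2 : ℕ) := by positivity
      push_cast at h1 ⊢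
      linarith
    have s3 := Finset.card_nsmul_le_sum _ _ _ s2
    rw [Nat.card_Ico, nsmul_eq_mul] at s3
    refine le_trans ?_ s3
    have : (i : ℝ) ≤ ((6 * i - (3 * i + 2) : ℕ) : ℝ) := by
      have : i ≤ 6 * i - (3 * i + 2) := by omega
      exact_mod_cast this
    nlinarith
  have hprodP : ∏ j : Fin D, ((4 * k * P ^ (j.1 + 1)) ^ 2 : ℝ) = (4 * k : ℝ) ^ (2 * D) * P ^ (2 * d) := by
    rw [Finset.prod_pow, Finset.prod_mul_distrib, Finset.prod_const, Finset.card_univ, Fintype.card_fin,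
      Fin.prod_univ_eq_prod_range (fun j => (P : ℝ) ^ (j + 1)) D, Finset.prod_pow_eq_pow_sum]
    have : ∑ j ∈ Finset.range D, (j + 1) = d := by
      have h1 := Finset.sum_range_id_mul_two (D + 1)
      rw [Finset.sum_range_succ', add_zero, Nat.add_sub_cancel] at h1
      have : (D + 1) * D = D * (D + 1) := by ring
      omega
    rw [this, mul_pow, ← pow_mul, ← pow_mul, mul_comm D 2, mul_comm d 2]
  have hPR : (0 : ℝ) < P := by exact_mod_cast hP0
  set L := 370 * lam * D ^ 3 + b0 * d with hL
  set SR := ∑ j ∈ Finset.range D, ρ (j + 1) with hSR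
  have hJR : (vmJ D k (Finset.range P) : ℝ) * P ^ d ≤ 2 ^ L * P ^ (2 * k) := by exact_mod_cast hJ
  have hexpo : 2 * L + 6 * lam * D + 16 * lam * k ^ 2 ≤ SR := by
    have hnum := vm_numeric N h lam D b0 k i d hhR hNR hlR hKR hD13R d1R (by exact_mod_cast hb0) (by positivity)
      (by positivity) (by exact_mod_cast hk) (by nlinarith) (by exact_mod_cast hdd)
    have : ((2 * L + 6 * lam * D + 16 * lam * k ^ 2 : ℕ) : ℝ) ≤ SR := by
      rw [hL]
      push_cast
      exact hnum.trans hρsum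
    exact_mod_cast this
  have h4k : (4 * k : ℝ) ^ (2 * D) ≤ 2 ^ (6 * lam * D) := by
    have : (4 * k : ℝ) ≤ 2 ^ (3 * lam) := by
      have : 4 * k ≤ 2 ^ (3 * lam) := by
        calc 4 * k ≤ 4 * 2 ^ lam := by omega
          _ = 2 ^ (2 + lam) := by rw [pow_add]; norm_num
          _ ≤ _ := Nat.pow_le_pow_right (by norm_num) (by omega)
      exact_mod_cast this
    calc (4 * k : ℝ) ^ (2 * D) ≤ (2 ^ (3 * lam)) ^ (2 * D) := by gcongr
      _ = _ := by rw [← pow_mul]; congr 1; ring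
  have hfinal : ‖W‖ ^ (2 * k * (2 * k)) ≤ ((P : ℝ) ^ 2 / 2 ^ (4 * lam)) ^ (2 * k * (2 * k)) := by
    refine hbil.trans ?_
    rw [Finset.prod_div_distrib, hprodR, hprodP, div_pow, ← mul_div_assoc,
      div_le_div_iff₀ (by positivity) (by positivity)]
    set J := (vmJ D k (Finset.range P) : ℝ)
    calc (P : ℝ) ^ (4 * k * (2 * k - 1)) * J ^ 2 * ((4 * k : ℝ) ^ (2 * D) * P ^ (2 * d)) * (2 ^ (4 * lam)) ^ (2 * k * (2 * k))
        = (P : ℝ) ^ (4 * k * (2 * k - 1)) * (J * P ^ d) ^ 2 * (4 * k : ℝ) ^ (2 * D) * 2 ^ (16 * lam * k ^ 2) := by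
          rw [← pow_mul, show 4 * lam * (2 * k * (2 * k)) = 16 * lam * k ^ 2 by ring]
          ring
      _ ≤ (P : ℝ) ^ (4 * k * (2 * k - 1)) * (2 ^ L * P ^ (2 * k)) ^ 2 * 2 ^ (6 * lam * D) * 2 ^ (16 * lam * k ^ 2) := by
          gcongr
      _ = (P : ℝ) ^ (4 * k * (2 * k - 1) + 4 * k) * 2 ^ (2 * L + 6 * lam * D + 16 * lam * k ^ 2) := by
          ring
      _ ≤ (P : ℝ) ^ (4 * k * (2 * k - 1) + 4 * k) * 2 ^ SR := by
          gcongr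
          · norm_num
      _ = _ := by
          rw [← pow_mul]
          congr 2
          obtain ⟨m, rfl⟩ : ∃ m, k = m + 1 := ⟨k - 1, by omega⟩
          rw [show 2 * (m + 1) - 1 = 2 * m + 1 by omega]
          ring
  exact le_of_pow_le_pow_left₀ (by positivity) (by positivity) hfinal


theorem vm_odd_inv (x : ℤ) (hx : Odd x) (n : ℕ) : ∃ w : ℤ, (2 : ℤ) ^ n ∣ x * w - 1 := by
  have hcop : IsCoprime x ((2 : ℤ) ^ n) := by
    apply IsCoprime.pow_right
    rw [Int.isCoprime_iff_gcd_eq_one, Int.gcd_comm]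
    exact Int.isCoprime_iff_gcd_eq_one.1 (Int.isCoprime_two_left.2 hx)
  obtain ⟨u, v, huv⟩ := hcop
  exact ⟨u, -v, by linarith⟩

theorem vm_shift_twist (g : ℤ → ℂ) (n : ℕ) (hmul : ∀ x y, g (x * y) = g x * g y)
    (hper : ∀ x y, (2 : ℤ) ^ n ∣ x - y → g x = g y) (x w q : ℤ) (hw : (2 : ℤ) ^ n ∣ x * w - 1) :
    g (x + q) = g x * g (1 + w * q) := by
  rw [← hmul]
  apply hper
  have : x + q - x * (1 + w * q) = (x * w - 1) * (-q) := by ring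
  rw [this]
  exact hw.mul_right _

theorem vm_level (g : ℤ → ℂ) (n N : ℕ) (hmul : ∀ x y, g (x * y) = g x * g y)
    (hper : ∀ x y, (2 : ℤ) ^ n ∣ x - y → g x = g y) (hev : ∀ x, Even x → g x = 0)
    (hN : 1 ≤ N) (hNt : ∀ y : ℤ, g (1 + 2 ^ N * y) = 1) (x y : ℤ) (hxy : (2 : ℤ) ^ N ∣ x - y) : g x = g y := by
  have h2 : (2 : ℤ) ∣ x - y := (dvd_pow_self 2 (by omega)).trans hxy
  rcases Int.even_or_odd y with hy | hy
  · have hx : Even x := by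
      have h3 : Even (x - y) := even_iff_two_dvd.2 h2
      simpa using h3.add hy
    rw [hev x hx, hev y hy]
  · obtain ⟨w, hw⟩ := vm_odd_inv y hy n
    obtain ⟨z, hz⟩ := hxy
    have := vm_shift_twist g n hmul hper y w (2 ^ N * z) hw
    rw [show y + 2 ^ N * z = x by linarith, show 1 + w * (2 ^ N * z) = 1 + 2 ^ N * (w * z) by ring, hNt, mul_one] at this
    exact this

theorem vm_complete (g : ℤ → ℂ) (h : ℕ) (hmul : ∀ x y, g (x * y) = g x * g y)
    (hper : ∀ x y, (2 : ℤ) ^ h ∣ x - y → g x = g y) (x0 : ℤ) (hx0 : Odd x0) (hg0 : g x0 ≠ 1) (a : ℤ) :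
    ∑ x ∈ Finset.range (2 ^ h), g (a + x) = 0 := by
  have : NeZero (2 ^ h) := ⟨by positivity⟩
  let G : ZMod (2 ^ h) → ℂ := fun z => g (z.val : ℤ)
  have hG : ∀ x : ℤ, G (x : ZMod (2 ^ h)) = g x := by
    intro x
    apply hper
    have : ((2 ^ h : ℕ) : ℤ) ∣ (((x : ZMod (2 ^ h)).val : ℤ) - x) := by
      rw [← ZMod.intCast_zmod_eq_zero_iff_dvd]
      push_cast
      simp
    exact_mod_cast this
  have e1 : ∑ x ∈ Finset.range (2 ^ h), g (a + x) = ∑ z : ZMod (2 ^ h), G ((a : ZMod (2 ^ h)) + z) := by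
    refine Finset.sum_bij' (fun x _ => (x : ZMod (2 ^ h))) (fun z _ => z.val) (fun _ _ => Finset.mem_univ _)
      (fun z _ => Finset.mem_range.2 (ZMod.val_lt z)) ?_ ?_ ?_
    · intro x hx
      exact ZMod.val_cast_of_lt (Finset.mem_range.1 hx)
    · intro z _
      simp
    · intro x _
      rw [← hG]
      push_cast
      rfl
  have e2 : ∑ z : ZMod (2 ^ h), G ((a : ZMod (2 ^ h)) + z) = ∑ z : ZMod (2 ^ h), G z :=
    Fintype.sum_equiv (Equiv.addLeft (a : ZMod (2 ^ h))) _ _ (fun z => rfl)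
  have hu : IsUnit (x0 : ZMod (2 ^ h)) := by
    obtain ⟨w, hw⟩ := vm_odd_inv x0 hx0 h
    have : ((2 ^ h : ℕ) : ℤ) ∣ x0 * w - 1 := by exact_mod_cast hw
    rw [← ZMod.intCast_zmod_eq_zero_iff_dvd] at this
    push_cast at this
    exact IsUnit.of_mul_eq_one _ (sub_eq_zero.1 this)
  obtain ⟨u, hu⟩ := hu
  have e3 : ∑ z : ZMod (2 ^ h), G ((x0 : ZMod (2 ^ h)) * z) = ∑ z : ZMod (2 ^ h), G z := by
    refine Fintype.sum_equiv (Units.mulLeft u) _ _ (fun z => ?_)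
    rw [Units.mulLeft_apply, hu]
  have e4 : ∑ z : ZMod (2 ^ h), G ((x0 : ZMod (2 ^ h)) * z) = g x0 * ∑ z : ZMod (2 ^ h), G z := by
    rw [Finset.mul_sum]
    refine Finset.sum_congr rfl fun z _ => ?_
    have : (x0 : ZMod (2 ^ h)) * z = ((x0 * (z.val : ℤ) : ℤ) : ZMod (2 ^ h)) := by
      push_cast
      simp
    rw [this, hG, hmul]
  rw [e1, e2]
  rw [e3] at e4
  have : (g x0 - 1) * ∑ z : ZMod (2 ^ h), G z = 0 := by
    rw [sub_mul, one_mul, ← e4, sub_self]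
  exact (mul_eq_zero.1 this).resolve_left (sub_ne_zero.2 hg0)

theorem vm_shift_err (f : ℕ → ℂ) (hf : ∀ x, ‖f x‖ ≤ 1) (M q : ℕ) :
    ‖∑ x ∈ Finset.range M, f x - ∑ x ∈ Finset.range M, f (q + x)‖ ≤ 2 * q := by
  have h1 := Finset.sum_range_add f M q
  have h2 := Finset.sum_range_add f q M
  rw [add_comm q M, h1] at h2
  have h3 : ∑ x ∈ Finset.range M, f x - ∑ x ∈ Finset.range M, f (q + x)
      = ∑ x ∈ Finset.range q, f x - ∑ x ∈ Finset.range q, f (M + x) := by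
    linear_combination h2
  rw [h3]
  have b : ∀ F : ℕ → ℂ, (∀ x, ‖F x‖ ≤ 1) → ‖∑ x ∈ Finset.range q, F x‖ ≤ q := by
    intro F hF
    refine (norm_sum_le _ _).trans ((Finset.sum_le_sum fun x _ => hF x).trans ?_)
    simp
  have := norm_sub_le (∑ x ∈ Finset.range q, f x) (∑ x ∈ Finset.range q, f (M + x))
  have := b f hf
  have := b (fun x => f (M + x)) (fun x => hf _)
  linarith

theorem vm_short (g : ℤ → ℂ) (n h lam : ℕ) (h1 : g 1 = 1) (hmul : ∀ x y, g (x * y) = g x * g y)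
    (hper : ∀ x y, (2 : ℤ) ^ n ∣ x - y → g x = g y) (hev : ∀ x, Even x → g x = 0)
    (hnorm : ∀ x, ‖g x‖ ≤ 1) (hnt : ∃ x, Odd x ∧ g x ≠ 1) (hn : 1 ≤ n) (hh : 1 ≤ h) (hlam : 1 ≤ lam)
    (hnl : n ≤ 2 ^ lam) (hK : 10 ^ 10 * lam * n ^ 2 ≤ h ^ 3) (a : ℤ) :
    ‖∑ x ∈ Finset.range (2 ^ h), g (a + x)‖ ≤ 2 * 2 ^ h / 2 ^ (4 * lam) := by
  classical
  have hex : ∃ N : ℕ, 1 ≤ N ∧ ∀ y : ℤ, g (1 + 2 ^ N * y) = 1 :=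
    ⟨n, hn, fun y => by rw [hper (1 + 2 ^ n * y) 1 (by simp), h1]⟩
  set N := Nat.find hex with hNdef
  obtain ⟨hN1, hNt⟩ := Nat.find_spec hex
  rw [← hNdef] at hN1 hNt
  have hNn : N ≤ n := Nat.find_min' hex ⟨hn, fun y => by rw [hper (1 + 2 ^ n * y) 1 (by simp), h1]⟩
  have hperN := vm_level g n N hmul hper hev hN1 hNt
  have hN2 : 2 ≤ N := by
    by_contra hcon
    have hN : N = 1 := by omega
    obtain ⟨x, ⟨y, hy⟩, hx⟩ := hnt
    apply hx
    have := hNt y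
    rw [hN, pow_one] at this
    rw [hy, add_comm]
    exact this
  have hy : ∃ y : ℤ, g (1 + 2 ^ (N - 1) * y) ≠ 1 := by
    by_contra hcon
    push Not at hcon
    exact Nat.find_min hex (m := N - 1) (by omega) ⟨by omega, hcon⟩
  by_cases hhN : N ≤ h
  · obtain ⟨y, hy⟩ := hy
    rw [vm_complete g h hmul (fun x y hxy => hperN x y ((pow_dvd_pow 2 hhN).trans hxy)) (1 + 2 ^ (N - 1) * y) ?_ hy a]
    · rw [norm_zero]
      positivity
    · apply Odd.add_even odd_one
      apply Even.mul_right
      exact (even_two.pow_of_ne_zero (by omega))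
  push Not at hhN
  have hKN : 10 ^ 10 * lam * N ^ 2 ≤ h ^ 3 := le_trans (by gcongr) hK
  have hhl : 10 ^ 10 * lam ≤ h := by
    have e1 : 10 ^ 10 * lam * N ^ 2 ≤ h * N ^ 2 := by
      calc 10 ^ 10 * lam * N ^ 2 ≤ h ^ 3 := hKN
        _ = h * h ^ 2 := by ring
        _ ≤ _ := by gcongr
    exact Nat.le_of_mul_le_mul_right e1 (by positivity)
  obtain ⟨c, hc, hlog⟩ := vm_char_log g N (by omega) h1 hmul hperN hy
  obtain ⟨P, hP0, hP, hin⟩ := vm_inner g N h lam c hc hhN hh hlam (hNn.trans hnl) hKN hlog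
  set t := h / 10 with ht
  have ht1 : 1 ≤ t := by omega
  have hPR : (0 : ℝ) < P := by exact_mod_cast hP0
  -- pointwise bound
  have hpt : ∀ y : ℤ, ‖∑ u ∈ Finset.range P, ∑ v ∈ Finset.range P, g (y + 2 ^ t * ((u : ℤ) * v))‖
      ≤ (P : ℝ) ^ 2 / 2 ^ (4 * lam) := by
    intro y
    rcases Int.even_or_odd y with hy | hy
    · have : ∑ u ∈ Finset.range P, ∑ v ∈ Finset.range P, g (y + 2 ^ t * ((u : ℤ) * v)) = 0 := by
        refine Finset.sum_eq_zero fun u _ => Finset.sum_eq_zero fun v _ => hev _ ?_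
        apply hy.add
        apply Even.mul_right
        exact (even_two.pow_of_ne_zero (by omega))
      rw [this, norm_zero]
      positivity
    · obtain ⟨w, hw⟩ := vm_odd_inv y hy n
      have hwodd : Odd w := by
        have h2 : (2 : ℤ) ∣ y * w - 1 := (dvd_pow_self 2 (by omega)).trans hw
        have h3 : Odd (y * w) := by
          have := (even_iff_two_dvd.2 h2).add_odd odd_one
          simpa using this
        exact (Int.odd_mul.1 h3).2
      have : ∑ u ∈ Finset.range P, ∑ v ∈ Finset.range P, g (y + 2 ^ t * ((u : ℤ) * v))
          = g y * ∑ u ∈ Finset.range P, ∑ v ∈ Finset.range P, g (1 + 2 ^ t * w * ((u : ℤ) * v)) := by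
        rw [Finset.mul_sum]
        refine Finset.sum_congr rfl fun u _ => ?_
        rw [Finset.mul_sum]
        refine Finset.sum_congr rfl fun v _ => ?_
        rw [vm_shift_twist g n hmul hper y w _ hw]
        congr 2
        ring
      rw [this, norm_mul]
      calc _ ≤ 1 * ((P : ℝ) ^ 2 / 2 ^ (4 * lam)) := by
            apply mul_le_mul (hnorm y) (hin w hwodd) (norm_nonneg _) zero_le_one
        _ = _ := one_mul _
  set S := ∑ x ∈ Finset.range (2 ^ h), g (a + x) with hS
  have hshift : ∀ u ∈ Finset.range P, ∀ v ∈ Finset.range P,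
      ‖S - ∑ x ∈ Finset.range (2 ^ h), g ((a + x) + 2 ^ t * ((u : ℤ) * v))‖ ≤ 2 * (2 ^ t * (P : ℝ) ^ 2) := by
    intro u hu v hv
    have := vm_shift_err (fun x : ℕ => g (a + x)) (fun x => hnorm _) (2 ^ h) (2 ^ t * (u * v))
    have e : ∑ x ∈ Finset.range (2 ^ h), g (a + ((2 ^ t * (u * v) + x : ℕ) : ℤ))
        = ∑ x ∈ Finset.range (2 ^ h), g ((a + x) + 2 ^ t * ((u : ℤ) * v)) := by
      refine Finset.sum_congr rfl fun x _ => ?_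
      congr 1
      push_cast
      ring
    rw [e] at this
    refine this.trans ?_
    have hu' : (u : ℝ) ≤ P := by exact_mod_cast (Finset.mem_range.1 hu).le
    have hv' : (v : ℝ) ≤ P := by exact_mod_cast (Finset.mem_range.1 hv).le
    push_cast
    have : (u : ℝ) * v ≤ P * P := by gcongr
    rw [sq]
    gcongr
  have hsum : (P : ℂ) ^ 2 * S = ∑ u ∈ Finset.range P, ∑ v ∈ Finset.range P,
        (S - ∑ x ∈ Finset.range (2 ^ h), g ((a + x) + 2 ^ t * ((u : ℤ) * v)))
      + ∑ x ∈ Finset.range (2 ^ h), ∑ u ∈ Finset.range P, ∑ v ∈ Finset.range P, g ((a + x) + 2 ^ t * ((u : ℤ) * v)) := by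
    have sw : ∑ x ∈ Finset.range (2 ^ h), ∑ u ∈ Finset.range P, ∑ v ∈ Finset.range P, g ((a + x) + 2 ^ t * ((u : ℤ) * v))
        = ∑ u ∈ Finset.range P, ∑ v ∈ Finset.range P, ∑ x ∈ Finset.range (2 ^ h), g ((a + x) + 2 ^ t * ((u : ℤ) * v)) := by
      rw [Finset.sum_comm]
      refine Finset.sum_congr rfl fun u _ => ?_
      rw [Finset.sum_comm]
    rw [sw]
    simp only [Finset.sum_sub_distrib]
    rw [sub_add_cancel]
    simp
    ring
  have hb1 : ‖∑ u ∈ Finset.range P, ∑ v ∈ Finset.range P,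
        (S - ∑ x ∈ Finset.range (2 ^ h), g ((a + x) + 2 ^ t * ((u : ℤ) * v)))‖ ≤ (P : ℝ) ^ 2 * (2 * (2 ^ t * (P : ℝ) ^ 2)) := by
    calc _ ≤ ∑ u ∈ Finset.range P, ∑ v ∈ Finset.range P, (2 * (2 ^ t * (P : ℝ) ^ 2)) :=
          (norm_sum_le _ _).trans (Finset.sum_le_sum fun u hu => (norm_sum_le _ _).trans
            (Finset.sum_le_sum fun v hv => hshift u hu v hv))
      _ = _ := by
        simp
        ring
  have hb2 : ‖∑ x ∈ Finset.range (2 ^ h), ∑ u ∈ Finset.range P, ∑ v ∈ Finset.range P, g ((a + x) + 2 ^ t * ((u : ℤ) * v))‖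
      ≤ 2 ^ h * ((P : ℝ) ^ 2 / 2 ^ (4 * lam)) := by
    calc _ ≤ ∑ x ∈ Finset.range (2 ^ h), ((P : ℝ) ^ 2 / 2 ^ (4 * lam)) :=
          (norm_sum_le _ _).trans (Finset.sum_le_sum fun x _ => hpt _)
      _ = _ := by simp
  have hsmall : 2 * (2 ^ t * (P : ℝ) ^ 2) ≤ 2 ^ h / 2 ^ (4 * lam) := by
    have hPP : (P : ℝ) ≤ (2 : ℝ) ^ (0.4 * (h : ℝ)) := by
      rw [← Real.logb_le_iff_le_rpow (by norm_num) hPR]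
      exact hP
    have hPP2 : (P : ℝ) ^ 2 ≤ (2 : ℝ) ^ (0.8 * (h : ℝ)) := by
      calc (P : ℝ) ^ 2 ≤ ((2 : ℝ) ^ (0.4 * (h : ℝ))) ^ 2 := by gcongr
        _ = _ := by rw [← Real.rpow_natCast, ← Real.rpow_mul (by norm_num)]; congr 1; push_cast; ring
    have ht10 : (t : ℝ) * 10 ≤ h := by exact_mod_cast Nat.div_mul_le_self h 10
    have hlR : (1 : ℝ) ≤ lam := by exact_mod_cast hlam
    have hhlR : (10 : ℝ) ^ 10 * lam ≤ h := by exact_mod_cast hhl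
    rw [le_div_iff₀ (by positivity)]
    calc 2 * (2 ^ t * (P : ℝ) ^ 2) * 2 ^ (4 * lam)
        ≤ 2 * (2 ^ t * (2 : ℝ) ^ (0.8 * (h : ℝ))) * 2 ^ (4 * lam) := by gcongr
      _ = (2 : ℝ) ^ (1 + (t : ℝ) + 0.8 * h + (4 * lam : ℕ)) := by
        rw [Real.rpow_add (by norm_num), Real.rpow_add (by norm_num), Real.rpow_add (by norm_num), Real.rpow_one,
          Real.rpow_natCast, Real.rpow_natCast]
        ring
      _ ≤ (2 : ℝ) ^ (h : ℝ) := by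
        apply Real.rpow_le_rpow_of_exponent_le (by norm_num)
        push_cast
        linarith
      _ = _ := Real.rpow_natCast _ _
  have hfin : (P : ℝ) ^ 2 * ‖S‖ ≤ (P : ℝ) ^ 2 * (2 * 2 ^ h / 2 ^ (4 * lam)) := by
    calc (P : ℝ) ^ 2 * ‖S‖ = ‖(P : ℂ) ^ 2 * S‖ := by simp
      _ ≤ (P : ℝ) ^ 2 * (2 * (2 ^ t * (P : ℝ) ^ 2)) + 2 ^ h * ((P : ℝ) ^ 2 / 2 ^ (4 * lam)) := by
        rw [hsum]
        exact (norm_add_le _ _).trans (add_le_add hb1 hb2)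
      _ ≤ (P : ℝ) ^ 2 * (2 ^ h / 2 ^ (4 * lam)) + 2 ^ h * ((P : ℝ) ^ 2 / 2 ^ (4 * lam)) := by gcongr
      _ = _ := by ring
  exact le_of_mul_le_mul_left hfin (by positivity)


theorem vm_centralBinom_le (x : ℕ) (n_large : 2 < x) :
    Nat.centralBinom x ≤ (2 * x) ^ (((Finset.Ioc x (2 * x)).filter Nat.Prime).card + Nat.sqrt (2 * x))
      * 4 ^ (2 * x / 3) := by
  have n_pos : 0 < x := (Nat.zero_le _).trans_lt n_large
  have n2_pos : 1 ≤ 2 * x := by omega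
  let S := {p ∈ Finset.range (2 * x + 1) | Nat.Prime p}
  let f := fun y : ℕ => y ^ x.centralBinom.factorization y
  have hS : ∏ y ∈ S, f y = ∏ y ∈ Finset.range (2 * x + 1), f y := by
    refine Finset.prod_filter_of_ne fun p _ h => ?_
    contrapose h
    dsimp only [f]
    rw [Nat.factorization_eq_zero_of_not_prime x.centralBinom h, _root_.pow_zero]
  have hf : ∀ p, f p ≤ 2 * x := fun p => Nat.pow_factorization_choose_le (by omega)
  have hprod : x.centralBinom = ∏ y ∈ S, f y := by
    rw [hS]
    exact (x.prod_pow_factorization_centralBinom).symm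
  rw [hprod, ← Finset.prod_filter_mul_prod_filter_not S (fun p => p ≤ Nat.sqrt (2 * x) ∨ x < p)]
  apply mul_le_mul'
  · refine (Finset.prod_le_prod' fun p _ => hf p).trans ?_
    rw [Finset.prod_const]
    refine pow_right_mono₀ n2_pos ?_
    have hsub : S.filter (fun p => p ≤ Nat.sqrt (2 * x) ∨ x < p)
        ⊆ ((Finset.Ioc x (2 * x)).filter Nat.Prime) ∪ Finset.Icc 1 (Nat.sqrt (2 * x)) := by
      intro p hp
      simp only [S, Finset.mem_filter, Finset.mem_range, Finset.mem_union, Finset.mem_Ioc, Finset.mem_Icc] at hp ⊢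
      obtain ⟨⟨h1, h2⟩, h3 | h3⟩ := hp
      · right
        exact ⟨h2.one_lt.le, h3⟩
      · left
        exact ⟨⟨h3, by omega⟩, h2⟩
    refine (Finset.card_le_card hsub).trans ((Finset.card_union_le _ _).trans ?_)
    simp
  · refine le_trans ?_ (primorial_le_four_pow (2 * x / 3))
    have hz : ∏ p ∈ S.filter (fun p => ¬ (p ≤ Nat.sqrt (2 * x) ∨ x < p)), f p
        ≤ ∏ p ∈ (S.filter (fun p => ¬ (p ≤ Nat.sqrt (2 * x) ∨ x < p))).filter (fun p => p ≤ 2 * x / 3), p := by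
      conv_rhs => rw [Finset.prod_filter]
      refine Finset.prod_le_prod' fun p hp => ?_
      simp only [S, Finset.mem_filter, Finset.mem_range, not_or, not_le, not_lt] at hp
      obtain ⟨⟨h1, h2⟩, h3, h4⟩ := hp
      split_ifs with hc
      · refine (pow_right_mono₀ h2.one_lt.le ?_).trans (pow_one p).le
        exact Nat.factorization_choose_le_one (Nat.sqrt_lt'.mp h3)
      · dsimp only [f]
        rw [Nat.factorization_centralBinom_of_two_mul_self_lt_three_mul n_large h4 (by omega), pow_zero]
    refine hz.trans ?_
    unfold primorial
    refine Finset.prod_le_prod_of_subset_of_one_le' ?_ ?_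
    · intro p hp
      simp only [S, Finset.mem_filter, Finset.mem_range] at hp ⊢
      exact ⟨by omega, hp.1.1.2⟩
    · intro p hp _
      exact (Finset.mem_filter.1 hp).2.one_lt.le

theorem vm_prime_lower (n : ℕ) (hn : 20 ≤ n) : 2 ^ n ≤ 6 * n * (primesP n).card := by
  set x := 2 ^ (n - 1) with hx
  have h2x : 2 * x = 2 ^ n := by
    rw [hx, ← pow_succ']
    congr 1
    omega
  have hxl : 512 ≤ x := by
    calc 512 = 2 ^ 9 := by norm_num
      _ ≤ _ := Nat.pow_le_pow_right (by norm_num) (by omega)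
  have hcard : ((Finset.Ioc x (2 * x)).filter Nat.Prime).card = (primesP n).card := by
    congr 1
    ext p
    simp only [primesP, Finset.mem_filter, Finset.mem_Ioc, Finset.mem_Ioo, h2x]
    constructor
    · rintro ⟨⟨h1, h2⟩, h3⟩
      refine ⟨⟨h1, lt_of_le_of_ne h2 ?_⟩, h3⟩
      rintro rfl
      exact Nat.Prime.not_prime_pow (by omega) h3
    · rintro ⟨⟨h1, h2⟩, h3⟩
      exact ⟨⟨h1, h2.le⟩, h3⟩
  have h1 := vm_centralBinom_le x (by omega)
  have h2 := Nat.four_pow_lt_mul_centralBinom x (by omega)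
  rw [hcard, h2x] at h1
  set π := (primesP n).card
  set r := Nat.sqrt (2 ^ n) with hr
  have h3 : 2 ^ (2 * x) < 2 ^ (n * (π + r + 1) + 2 * (2 ^ n / 3)) := by
    calc 2 ^ (2 * x) = 4 ^ x := by rw [pow_mul]; norm_num
      _ < x * x.centralBinom := h2
      _ ≤ 2 ^ n * ((2 ^ n) ^ (π + r) * 4 ^ (2 ^ n / 3)) := by
        apply Nat.mul_le_mul _ h1
        omega
      _ = _ := by
        rw [show (4 : ℕ) = 2 ^ 2 by norm_num, ← pow_mul, ← pow_mul, ← pow_add, ← pow_add]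
        congr 1
        ring
  have h4 := (Nat.pow_lt_pow_iff_right (by norm_num)).1 h3
  have hr1 : r * r ≤ 2 ^ n := Nat.sqrt_le _
  have hr0 : 1 ≤ r := Nat.sqrt_pos.2 (by positivity)
  have h144 : 144 * n ^ 2 ≤ 2 ^ n := by
    clear * - hn
    induction n, hn using Nat.le_induction with
    | base => norm_num
    | succ k hk ih =>
      rw [pow_succ 2 k]
      nlinarith
  have h5 : 6 * (n * (r + 1)) ≤ 2 ^ n := by
    have : (6 * (n * (r + 1))) ^ 2 ≤ (2 ^ n) ^ 2 := by
      calc (6 * (n * (r + 1))) ^ 2 ≤ (6 * (n * (r + r))) ^ 2 := by gcongr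
        _ = 144 * n ^ 2 * (r * r) := by ring
        _ ≤ 2 ^ n * 2 ^ n := Nat.mul_le_mul h144 hr1
        _ = _ := by ring
    exact le_of_pow_le_pow_left₀ (by norm_num) (by positivity) this
  rw [h2x] at h4
  have e : n * (π + r + 1) = n * π + n * (r + 1) := by ring
  have e2 : 6 * n * π = 6 * (n * π) := by ring
  rw [e] at h4
  rw [e2]
  omega


theorem vm_prime_isUnit (n : ℕ) (hn : 2 ≤ n) (p : ℕ) (hp : p ∈ primesP n) : IsUnit (p : ZMod (2 ^ n)) := by
  rw [ZMod.isUnit_iff_coprime]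
  apply Nat.Coprime.pow_right
  simp only [primesP, Finset.mem_filter, Finset.mem_Ioo] at hp
  rw [Nat.coprime_comm, Nat.coprime_primes Nat.prime_two hp.2]
  have : 2 ^ 1 ≤ 2 ^ (n - 1) := Nat.pow_le_pow_right (by norm_num) (by omega)
  omega

theorem vm_sum_norm_sq (n : ℕ) (hn : 2 ≤ n) :
    ∑ χ : DirichletCharacter ℂ (2 ^ n), ‖∑ p ∈ primesP n, χ ((p : ZMod (2 ^ n))⁻¹)‖ ^ 2
      = ((2 ^ n).totient : ℝ) * (primesP n).card := by
  have key : ((∑ χ : DirichletCharacter ℂ (2 ^ n), ‖∑ p ∈ primesP n, χ ((p : ZMod (2 ^ n))⁻¹)‖ ^ 2 : ℝ) : ℂ)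
      = (((2 ^ n).totient : ℝ) * (primesP n).card : ℝ) := by
    push_cast
    have e1 : ∀ χ : DirichletCharacter ℂ (2 ^ n), (‖∑ p ∈ primesP n, χ ((p : ZMod (2 ^ n))⁻¹)‖ : ℂ) ^ 2
        = ∑ p ∈ primesP n, ∑ l ∈ primesP n, χ ((p : ZMod (2 ^ n))⁻¹) * χ (l : ZMod (2 ^ n)) := by
      intro χ
      rw [← Complex.mul_conj', map_sum, Finset.sum_mul_sum]
      refine Finset.sum_congr rfl fun p _ => Finset.sum_congr rfl fun l hl => ?_
      congr 1
      have hu := vm_prime_isUnit n hn l hl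
      have h1 := MulChar.star_apply' χ ((l : ZMod (2 ^ n))⁻¹)
      rw [RCLike.star_def] at h1
      rw [h1, MulChar.inv_apply_eq_inv']
      apply inv_eq_of_mul_eq_one_right
      rw [← map_mul, ZMod.inv_mul_of_unit _ hu, map_one]
    simp only [e1]
    rw [Finset.sum_comm]
    have e2 : ∀ p ∈ primesP n, ∑ χ : DirichletCharacter ℂ (2 ^ n), ∑ l ∈ primesP n,
        χ ((p : ZMod (2 ^ n))⁻¹) * χ (l : ZMod (2 ^ n)) = ((2 ^ n).totient : ℂ) := by
      intro p hp
      rw [Finset.sum_comm]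
      have e3 : ∀ l ∈ primesP n, ∑ χ : DirichletCharacter ℂ (2 ^ n), χ ((p : ZMod (2 ^ n))⁻¹) * χ (l : ZMod (2 ^ n))
          = if p = l then ((2 ^ n).totient : ℂ) else 0 := by
        intro l hl
        rw [DirichletCharacter.sum_char_inv_mul_char_eq ℂ (vm_prime_isUnit n hn p hp)]
        have : ((p : ZMod (2 ^ n)) = l) ↔ p = l := by
          simp only [primesP, Finset.mem_filter, Finset.mem_Ioo] at hp hl
          constructor
          · intro h
            rw [ZMod.natCast_eq_natCast_iff] at h
            exact Nat.ModEq.eq_of_lt_of_lt h hp.1.2 hl.1.2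
          · rintro rfl
            rfl
        simp only [this]
      rw [Finset.sum_congr rfl e3]
      simp [hp]
    rw [Finset.sum_congr rfl e2]
    simp
    ring
  exact_mod_cast key

theorem vm_sum_countN (n m s : ℕ) (hn : 2 ≤ n) :
    (((2 ^ n).totient : ℂ)) * ∑ k ∈ Finset.range (2 ^ (n - m)), (countN n m s (k : ℤ) : ℂ)
      = ∑ χ : DirichletCharacter ℂ (2 ^ n), (∑ p ∈ primesP n, χ ((p : ZMod (2 ^ n))⁻¹)) ^ 2 *
        ∑ k ∈ Finset.range (2 ^ (n - m)), χ (((2 ^ (n - m) * s : ℤ) + k : ℤ) : ZMod (2 ^ n)) := by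
  have e1 : ∀ χ : DirichletCharacter ℂ (2 ^ n), (∑ p ∈ primesP n, χ ((p : ZMod (2 ^ n))⁻¹)) ^ 2 *
        ∑ k ∈ Finset.range (2 ^ (n - m)), χ (((2 ^ (n - m) * s : ℤ) + k : ℤ) : ZMod (2 ^ n))
      = ∑ k ∈ Finset.range (2 ^ (n - m)), ∑ pq ∈ primesP n ×ˢ primesP n,
          χ (((pq.1 * pq.2 : ℕ) : ZMod (2 ^ n))⁻¹) * χ (((2 ^ (n - m) * s : ℤ) + k : ℤ) : ZMod (2 ^ n)) := by
    intro χ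
    rw [sq, Finset.sum_mul_sum, ← Finset.sum_product', Finset.mul_sum]
    refine Finset.sum_congr rfl fun k _ => ?_
    rw [Finset.sum_mul]
    refine Finset.sum_congr rfl fun pq hpq => ?_
    rw [Finset.mem_product] at hpq
    congr 1
    have hp := vm_prime_isUnit n hn _ hpq.1
    have hq := vm_prime_isUnit n hn _ hpq.2
    rw [← map_mul]
    congr 1
    push_cast
    symm
    apply ZMod.inv_eq_of_mul_eq_one
    calc (pq.1 : ZMod (2 ^ n)) * pq.2 * ((pq.1 : ZMod (2 ^ n))⁻¹ * (pq.2 : ZMod (2 ^ n))⁻¹)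
        = (pq.1 * (pq.1 : ZMod (2 ^ n))⁻¹) * (pq.2 * (pq.2 : ZMod (2 ^ n))⁻¹) := by ring
      _ = 1 := by rw [ZMod.mul_inv_of_unit _ hp, ZMod.mul_inv_of_unit _ hq, one_mul]
  simp only [e1]
  rw [Finset.sum_comm, Finset.mul_sum]
  refine Finset.sum_congr rfl fun k _ => ?_
  rw [Finset.sum_comm]
  unfold countN
  rw [Finset.card_filter]
  push_cast
  rw [Finset.mul_sum]
  refine Finset.sum_congr rfl fun pq hpq => ?_
  rw [Finset.mem_product] at hpq
  have hp := vm_prime_isUnit n hn _ hpq.1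
  have hq := vm_prime_isUnit n hn _ hpq.2
  have hpq' : IsUnit ((pq.1 : ZMod (2 ^ n)) * (pq.2 : ZMod (2 ^ n))) := hp.mul hq
  rw [DirichletCharacter.sum_char_inv_mul_char_eq ℂ hpq']
  have hiff : ((pq.1 * pq.2 : ℤ) ≡ 2 ^ (n - m) * s + k [ZMOD 2 ^ n]) ↔
      ((pq.1 : ZMod (2 ^ n)) * pq.2 = (2 : ZMod (2 ^ n)) ^ (n - m) * s + k) := by
    have := ZMod.intCast_eq_intCast_iff (pq.1 * pq.2 : ℤ) (2 ^ (n - m) * s + k) (2 ^ n)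
    push_cast at this
    exact this.symm
  simp only [hiff]
  split_ifs <;> simp

theorem vm_principal (n h : ℕ) (hh : 1 ≤ h) (hn : 1 ≤ n) (s : ℤ) :
    ∑ k ∈ Finset.range (2 ^ h), (1 : DirichletCharacter ℂ (2 ^ n)) (((2 ^ h * s : ℤ) + k : ℤ) : ZMod (2 ^ n))
      = 2 ^ (h - 1) := by
  have e1 : ∀ k : ℕ, (1 : DirichletCharacter ℂ (2 ^ n)) (((2 ^ h * s : ℤ) + k : ℤ) : ZMod (2 ^ n))
      = if Odd k then 1 else 0 := by
    intro k
    have hiff : IsUnit (((2 ^ h * s : ℤ) + k : ℤ) : ZMod (2 ^ n)) ↔ Odd k := by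
      rw [ZMod.coe_int_isUnit_iff_isCoprime]
      push_cast
      rw [IsCoprime.pow_left_iff (by omega), Int.isCoprime_two_left]
      have : Even ((2 : ℤ) ^ h * s) := (even_two.pow_of_ne_zero (by omega)).mul_right _
      constructor
      · intro h1
        have := h1.sub_even this
        simpa using this
      · intro h1
        exact this.add_odd (by exact_mod_cast h1)
    by_cases hk : Odd k
    · rw [if_pos hk, MulChar.one_apply (hiff.2 hk)]
    · rw [if_neg hk, MulChar.map_nonunit _ (fun hu => hk (hiff.1 hu))]
  simp only [e1]
  obtain ⟨j, rfl⟩ : ∃ j, h = j + 1 := ⟨h - 1, by omega⟩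
  rw [Nat.add_sub_cancel]
  have : ∀ M : ℕ, ∑ k ∈ Finset.range (2 * M), (if Odd k then (1 : ℂ) else 0) = M := by
    intro M
    induction M with
    | zero => simp
    | succ M ih =>
      rw [show 2 * (M + 1) = 2 * M + 1 + 1 by ring, Finset.sum_range_succ, Finset.sum_range_succ, ih,
        if_neg (by simp), if_pos (by simp)]
      push_cast
      ring
  rw [pow_succ', this]
  push_cast
  rfl

theorem vm_reduction (n m s : ℕ) (hm : m < n) (hn : 2 ≤ n) (E : ℝ)
    (hE : ∀ χ : DirichletCharacter ℂ (2 ^ n), χ ≠ 1 →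
      ‖∑ k ∈ Finset.range (2 ^ (n - m)), χ (((2 ^ (n - m) * s : ℤ) + k : ℤ) : ZMod (2 ^ n))‖ ≤ E) (hE0 : 0 ≤ E) :
    |∑ k ∈ Finset.range (2 ^ (n - m)), (countN n m s (k : ℤ) : ℝ) - ((primesP n).card : ℝ) ^ 2 / 2 ^ m|
      ≤ E * (primesP n).card := by
  classical
  have h1 := vm_sum_countN n m s hn
  have hφ : (2 ^ n).totient = 2 ^ (n - 1) := by
    rw [Nat.totient_prime_pow Nat.prime_two (by omega)]
    simp
  have h2 := vm_sum_norm_sq n hn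
  rw [hφ] at h1 h2
  rw [← Finset.add_sum_erase _ _ (Finset.mem_univ (1 : DirichletCharacter ℂ (2 ^ n))),
    vm_principal n (n - m) (by omega) (by omega)] at h1
  have hA1 : ∑ p ∈ primesP n, (1 : DirichletCharacter ℂ (2 ^ n)) ((p : ZMod (2 ^ n))⁻¹) = (primesP n).card := by
    rw [Finset.sum_congr rfl (g := fun _ => (1 : ℂ))]
    · simp
    · intro p hp
      apply MulChar.one_apply
      have hu := vm_prime_isUnit n hn p hp
      exact IsUnit.of_mul_eq_one _ (ZMod.inv_mul_of_unit _ hu)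
  rw [hA1] at h1
  set T := ∑ χ ∈ Finset.univ.erase (1 : DirichletCharacter ℂ (2 ^ n)),
    (∑ p ∈ primesP n, χ ((p : ZMod (2 ^ n))⁻¹)) ^ 2 *
        ∑ k ∈ Finset.range (2 ^ (n - m)), χ (((2 ^ (n - m) * s : ℤ) + k : ℤ) : ZMod (2 ^ n)) with hT
  have hTb : ‖T‖ ≤ E * (2 ^ (n - 1) * (primesP n).card) := by
    calc ‖T‖ ≤ ∑ χ ∈ Finset.univ.erase (1 : DirichletCharacter ℂ (2 ^ n)),
          ‖∑ p ∈ primesP n, χ ((p : ZMod (2 ^ n))⁻¹)‖ ^ 2 * E := by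
          refine (norm_sum_le _ _).trans (Finset.sum_le_sum fun χ hχ => ?_)
          rw [norm_mul, norm_pow]
          gcongr
          exact hE χ (Finset.ne_of_mem_erase hχ)
      _ ≤ ∑ χ : DirichletCharacter ℂ (2 ^ n), ‖∑ p ∈ primesP n, χ ((p : ZMod (2 ^ n))⁻¹)‖ ^ 2 * E :=
          Finset.sum_le_sum_of_subset_of_nonneg (Finset.erase_subset _ _) (fun _ _ _ => by positivity)
      _ = _ := by
          rw [← Finset.sum_mul, h2]
          push_cast
          ring
  have hpow : (2 : ℂ) ^ (n - 1) = 2 ^ m * 2 ^ (n - m - 1) := by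
    rw [← pow_add]
    congr 1
    omega
  have h3 : (2 : ℂ) ^ (n - 1) * (∑ k ∈ Finset.range (2 ^ (n - m)), (countN n m s (k : ℤ) : ℂ)
      - ((primesP n).card : ℂ) ^ 2 / 2 ^ m) = T := by
    rw [mul_sub]
    push_cast at h1
    rw [h1, hpow]
    field_simp
    ring
  have h4 : ‖∑ k ∈ Finset.range (2 ^ (n - m)), (countN n m s (k : ℤ) : ℂ)
      - ((primesP n).card : ℂ) ^ 2 / 2 ^ m‖ = |∑ k ∈ Finset.range (2 ^ (n - m)), (countN n m s (k : ℤ) : ℝ) - ((primesP n).card : ℝ) ^ 2 / 2 ^ m| := by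
    rw [← Real.norm_eq_abs, ← Complex.norm_real]
    push_cast
    rfl
  rw [← h3, norm_mul, h4, norm_pow, Complex.norm_ofNat] at hTb
  have : (2 : ℝ) ^ (n - 1) * |∑ k ∈ Finset.range (2 ^ (n - m)), (countN n m s (k : ℤ) : ℝ) - ((primesP n).card : ℝ) ^ 2 / 2 ^ m|
      ≤ 2 ^ (n - 1) * (E * (primesP n).card) := by
    linarith
  exact le_of_mul_le_mul_left this (by positivity)


theorem vm_char_short (n h lam : ℕ) (χ : DirichletCharacter ℂ (2 ^ n)) (hχ : χ ≠ 1) (hn : 1 ≤ n) (hh : 1 ≤ h)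
    (hlam : 1 ≤ lam) (hnl : n ≤ 2 ^ lam) (hK : 10 ^ 10 * lam * n ^ 2 ≤ h ^ 3) (a : ℤ) :
    ‖∑ k ∈ Finset.range (2 ^ h), χ ((a + k : ℤ) : ZMod (2 ^ n))‖ ≤ 2 * 2 ^ h / 2 ^ (4 * lam) := by
  have hun : ∀ x : ℤ, IsUnit (x : ZMod (2 ^ n)) ↔ Odd x := by
    intro x
    rw [ZMod.coe_int_isUnit_iff_isCoprime]
    push_cast
    rw [IsCoprime.pow_left_iff (by omega), Int.isCoprime_two_left]
  refine vm_short (fun x : ℤ => χ (x : ZMod (2 ^ n))) n h lam (by simp) (fun x y => by simp) ?_ ?_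
    (fun x => DirichletCharacter.norm_le_one χ _) ?_ hn hh hlam hnl hK a
  · intro x y hxy
    have : ((x : ℤ) : ZMod (2 ^ n)) = y := by
      rw [← sub_eq_zero, ← Int.cast_sub, ZMod.intCast_zmod_eq_zero_iff_dvd]
      exact_mod_cast hxy
    simp only [this]
  · intro x hx
    apply MulChar.map_nonunit
    rw [hun]
    exact Int.not_odd_iff_even.2 hx
  · obtain ⟨u, hu⟩ := MulChar.ne_one_iff.1 hχ
    refine ⟨((u : ZMod (2 ^ n)).val : ℤ), ?_, ?_⟩
    · rw [← hun]
      simp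
    · simpa using hu

theorem vm_final : ∀ᶠ n : ℕ in Filter.atTop, ∀ m s : ℕ, m ≤ n → (n : ℝ) ^ ((3 : ℝ) / 4) ≤ ((n - m : ℕ) : ℝ) →
    |∑ k ∈ Finset.range (2 ^ (n - m)), (countN n m s (k : ℤ) : ℝ) - ((primesP n).card : ℝ) ^ 2 / 2 ^ m|
      ≤ 12 / n * (((primesP n).card : ℝ) ^ 2 / 2 ^ m) := by
  have hlo := (isLittleO_log_rpow_atTop (r := 1 / 4) (by norm_num)).bound (c := 1 / (3 * 10 ^ 10)) (by positivity)
  have hlo' := (tendsto_natCast_atTop_atTop (R := ℝ)).eventually hlo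
  filter_upwards [hlo', Filter.eventually_ge_atTop 20] with n hlog hn m s hmn hh
  have hnR : (20 : ℝ) ≤ n := by exact_mod_cast hn
  have hn0 : (0 : ℝ) < n := by linarith
  set h := n - m with hhdef
  have hpos : (0 : ℝ) < (n : ℝ) ^ ((3 : ℝ) / 4) := by positivity
  have hh1 : 1 ≤ h := by
    have : (0 : ℝ) < h := by linarith
    exact_mod_cast this
  set lam := Nat.log 2 n + 1 with hlam
  have hnl : n < 2 ^ lam := Nat.lt_pow_succ_log_self (by norm_num) n
  have hlog1 : 1 ≤ Real.log n := by
    rw [Real.le_log_iff_exp_le hn0]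
    have := Real.exp_one_lt_d9
    linarith
  have hlamR : (lam : ℝ) ≤ 3 * Real.log n := by
    have h1 : (Nat.log 2 n : ℝ) ≤ Real.logb 2 n := Real.natLog_le_logb n 2
    have h2 : Real.logb 2 n ≤ 2 * Real.log n := by
      rw [Real.logb, div_le_iff₀ (Real.log_pos (by norm_num))]
      have := Real.log_two_gt_d9
      nlinarith
    rw [hlam]
    push_cast
    linarith
  have hK : 10 ^ 10 * lam * n ^ 2 ≤ h ^ 3 := by
    have h1 : (10 : ℝ) ^ 10 * lam ≤ (n : ℝ) ^ (1 / 4 : ℝ) := by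
      rw [Real.norm_of_nonneg (by linarith), Real.norm_of_nonneg (by positivity)] at hlog
      have : (3 * 10 ^ 10) * Real.log n ≤ (n : ℝ) ^ (1 / 4 : ℝ) := by
        calc (3 * 10 ^ 10) * Real.log n ≤ (3 * 10 ^ 10) * (1 / (3 * 10 ^ 10) * (n : ℝ) ^ (1 / 4 : ℝ)) := by gcongr
          _ = _ := by field_simp
      linarith
    have h2 : (10 : ℝ) ^ 10 * lam * n ^ 2 ≤ (h : ℝ) ^ 3 := by
      calc (10 : ℝ) ^ 10 * lam * n ^ 2 ≤ (n : ℝ) ^ (1 / 4 : ℝ) * n ^ 2 := by gcongr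
        _ = ((n : ℝ) ^ ((3 : ℝ) / 4)) ^ 3 := by
          rw [← Real.rpow_natCast, ← Real.rpow_natCast, ← Real.rpow_add hn0, ← Real.rpow_mul hn0.le]
          norm_num
        _ ≤ _ := by gcongr
    exact_mod_cast h2
  have hred := vm_reduction n m s (by omega) (by omega) (2 * 2 ^ h / 2 ^ (4 * lam))
    (fun χ hχ => vm_char_short n h lam χ hχ (by omega) hh1 (by omega) hnl.le hK _) (by positivity)
  refine hred.trans ?_
  have hπ : (2 : ℝ) ^ n ≤ 6 * n * (primesP n).card := by exact_mod_cast vm_prime_lower n hn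
  set π := ((primesP n).card : ℝ)
  have hπ0 : 0 ≤ π := by positivity
  have h4 : (n : ℝ) ^ 4 ≤ 2 ^ (4 * lam) := by
    have : (n : ℝ) ≤ 2 ^ lam := by exact_mod_cast hnl.le
    calc (n : ℝ) ^ 4 ≤ (2 ^ lam) ^ 4 := by gcongr
      _ = _ := by rw [← pow_mul, mul_comm]
  have hpow : (2 : ℝ) ^ h * 2 ^ m = 2 ^ n := by
    rw [← pow_add]
    congr 1
    omega
  have h5 : 2 * 2 ^ h / 2 ^ (4 * lam) * (2 : ℝ) ^ m ≤ 12 / n * π := by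
    calc 2 * 2 ^ h / 2 ^ (4 * lam) * (2 : ℝ) ^ m = 2 * ((2 : ℝ) ^ h * 2 ^ m) / 2 ^ (4 * lam) := by ring
      _ = 2 * 2 ^ n / 2 ^ (4 * lam) := by rw [hpow]
      _ ≤ 2 * (6 * n * π) / (n : ℝ) ^ 4 := by gcongr
      _ = 12 / n * π / n ^ 2 := by
        field_simp
        ring
      _ ≤ 12 / n * π := by
        apply div_le_self (by positivity)
        nlinarith
  have h6 : (2 : ℝ) ^ m > 0 := by positivity
  calc 2 * 2 ^ h / 2 ^ (4 * lam) * π = (2 * 2 ^ h / 2 ^ (4 * lam) * (2 : ℝ) ^ m) * (π / 2 ^ m) := by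
        field_simp
    _ ≤ (12 / n * π) * (π / 2 ^ m) := by gcongr
    _ = _ := by ring

/-- With `m = ⌊n - n^(3/4) * ln n⌋`, for any `s < 2^m`, as `n → ∞`,
`∑_{k=0}^{2^(n-m)-1} N(k) = (1 + O(1/n)) · (#𝒫 n)² / 2^m`, uniformly in `s`. -/
theorem sum_countN_asymptotic :
    ∃ C : ℝ, 0 < C ∧ ∃ n₀ : ℕ, ∀ n : ℕ, n₀ ≤ n →
      ∀ s : ℕ, s < 2 ^ ⌊(n : ℝ) - (n : ℝ) ^ ((3 : ℝ)/4) * Real.log n⌋₊ →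
        |(∑ k ∈ Finset.range (2 ^ (n - ⌊(n : ℝ) - (n : ℝ) ^ ((3 : ℝ)/4) * Real.log n⌋₊)),
            (countN n ⌊(n : ℝ) - (n : ℝ) ^ ((3 : ℝ)/4) * Real.log n⌋₊ s (k : ℤ) : ℝ))
          - ((primesP n).card : ℝ) ^ 2 / 2 ^ ⌊(n : ℝ) - (n : ℝ) ^ ((3 : ℝ)/4) * Real.log n⌋₊|
        ≤ (C / n) * (((primesP n).card : ℝ) ^ 2
            / 2 ^ ⌊(n : ℝ) - (n : ℝ) ^ ((3 : ℝ)/4) * Real.log n⌋₊) := by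
  obtain ⟨n₀, hn₀⟩ := Filter.eventually_atTop.1 vm_final
  refine ⟨12, by norm_num, max n₀ 20, fun n hn s _ => ?_⟩
  have hn20 : (20 : ℝ) ≤ n := by exact_mod_cast (le_max_right n₀ 20).trans hn
  have hn0 : (0 : ℝ) < n := by linarith
  set m := ⌊(n : ℝ) - (n : ℝ) ^ ((3 : ℝ)/4) * Real.log n⌋₊ with hm
  have hlog1 : 1 ≤ Real.log n := by
    rw [Real.le_log_iff_exp_le hn0]
    have := Real.exp_one_lt_d9
    linarith
  have hpos : (0 : ℝ) < (n : ℝ) ^ ((3 : ℝ) / 4) := by positivity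
  have hle : (n : ℝ) ^ ((3 : ℝ) / 4) ≤ n := by
    calc (n : ℝ) ^ ((3 : ℝ) / 4) ≤ (n : ℝ) ^ (1 : ℝ) :=
          Real.rpow_le_rpow_of_exponent_le (by linarith) (by norm_num)
      _ = n := Real.rpow_one _
  have hmR : (m : ℝ) ≤ n - (n : ℝ) ^ ((3 : ℝ) / 4) := by
    rcases le_total 0 ((n : ℝ) - (n : ℝ) ^ ((3 : ℝ)/4) * Real.log n) with h | h
    · have := Nat.floor_le h
      rw [← hm] at this
      nlinarith
    · have : m = 0 := by rw [hm]; exact Nat.floor_of_nonpos h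
      rw [this]
      push_cast
      linarith
  have hmn : m ≤ n := by
    have : (m : ℝ) ≤ n := by linarith
    exact_mod_cast this
  refine hn₀ n ((le_max_left _ _).trans hn) m s hmn ?_
  rw [Nat.cast_sub hmn]
  linarith
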